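/- arXiv:1304.6263 — 5 statements merged into one kernel-verified Lean document; each statement's English description precedes it below -/
import Mathlib

section
/- Let r ≥ 13 be an integer and let G be an r-minimal graph. If uv is an edge of G with d_G(u) ≤ ⌊r/2⌋, then d_G(u) + d_G(v) ≥ r + 3. -/
/-- A total `k`-coloring of a simple graph `G`: colors from `Fin k` are assigned to all
vertices and to all edges so that adjacent vertices get distinct colors, distinct edges
sharing an endpoint get distinct colors, and each edge gets a color distinct from the
colors of both of its endpoints. -/
def HasTotalColoring {V : Type*} (G : SimpleGraph V) (k : ℕ) : Prop :=
  ∃ (cV : V → Fin k) (cE : Sym2 V → Fin k),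
    (∀ u v : V, G.Adj u v → cV u ≠ cV v) ∧
    (∀ e₁ ∈ G.edgeSet, ∀ e₂ ∈ G.edgeSet, e₁ ≠ e₂ → (∃ x, x ∈ e₁ ∧ x ∈ e₂) →
      cE e₁ ≠ cE e₂) ∧
    (∀ e ∈ G.edgeSet, ∀ x ∈ e, cE e ≠ cV x)

/-- For `r ≥ 13`, a graph is `r`-minimal if it is a finite connected simple graph with
maximum degree at most `r` admitting no total `(r+2)`-coloring, such that deleting any
edge yields a graph admitting a total `(r+2)`-coloring. -/
def IsRMinimal {V : Type*} [Fintype V] (r : ℕ) (G : SimpleGraph V)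
    [DecidableRel G.Adj] : Prop :=
  G.Connected ∧ G.maxDegree ≤ r ∧ ¬ HasTotalColoring G (r + 2) ∧
    ∀ e ∈ G.edgeSet, HasTotalColoring (G.deleteEdges {e}) (r + 2)

/-- Any finite set with fewer than `k` elements misses some color in `Fin k`. -/
lemma exists_fin_notMem_of_card_lt {k : ℕ} (s : Finset (Fin k)) (hs : s.card < k) :
    ∃ c, c ∉ s := by
  by_contra! h
  have : s = Finset.univ := Finset.eq_univ_iff_forall.2 h
  simp [this] at hs

/-- A total `k`-coloring of `G - uv` can be turned into one of `G` when `d(u) + d(v) ≤ k` and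
`2 d(u) < k`: color `uv` ignoring the color of `u`, then recolor `u`. -/
theorem HasTotalColoring.of_deleteEdges {V : Type*} [Fintype V] {k : ℕ}
    {G : SimpleGraph V} [DecidableRel G.Adj] {u v : V} (huv : G.Adj u v)
    (hsum : G.degree u + G.degree v ≤ k) (hu : 2 * G.degree u < k)
    (h : HasTotalColoring (G.deleteEdges {s(u, v)}) k) : HasTotalColoring G k := by
  classical
  obtain ⟨cV, cE, hV, hE, hVE⟩ := h
  have hmem : ∀ e, e ∈ (G.deleteEdges {s(u, v)}).edgeSet ↔ e ∈ G.edgeSet ∧ e ≠ s(u, v) := by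
    simp
  obtain ⟨c, hc⟩ := exists_fin_notMem_of_card_lt
    (insert (cV v) (((G.neighborFinset u).erase v).image (fun w => cE s(u, w)) ∪
      ((G.neighborFinset v).erase u).image (fun w => cE s(v, w)))) (by
    have h1 := Finset.card_image_le (s := (G.neighborFinset u).erase v) (f := fun w => cE s(u, w))
    have h2 := Finset.card_image_le (s := (G.neighborFinset v).erase u) (f := fun w => cE s(v, w))
    rw [Finset.card_erase_of_mem (by simpa using huv), G.card_neighborFinset_eq_degree] at h1
    rw [Finset.card_erase_of_mem (by simpa using huv.symm), G.card_neighborFinset_eq_degree] at h2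
    have h3 := G.degree_pos_iff_exists_adj u |>.2 ⟨v, huv⟩
    have h4 := G.degree_pos_iff_exists_adj v |>.2 ⟨u, huv.symm⟩
    refine (Finset.card_insert_le _ _).trans_lt ?_
    have h5 := Finset.card_union_le
      (((G.neighborFinset u).erase v).image (fun w => cE s(u, w)))
      (((G.neighborFinset v).erase u).image (fun w => cE s(v, w)))
    omega)
  simp only [Finset.mem_insert, Finset.mem_union, Finset.mem_image, Finset.mem_erase,
    SimpleGraph.mem_neighborFinset, not_or, not_exists, not_and, and_imp] at hc
  obtain ⟨hcv, hcu, hcw⟩ := hc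
  set cE' := Function.update cE s(u, v) c with hcE'
  have hcE'_self : cE' s(u, v) = c := by simp [hcE']
  have hcE'_ne : ∀ e, e ≠ s(u, v) → cE' e = cE e := fun e he => by simp [hcE', he]
  obtain ⟨d, hd⟩ := exists_fin_notMem_of_card_lt
    ((G.neighborFinset u).image cV ∪ (G.neighborFinset u).image (fun w => cE' s(u, w))) (by
    have h1 := Finset.card_image_le (s := G.neighborFinset u) (f := cV)
    have h2 := Finset.card_image_le (s := G.neighborFinset u) (f := fun w => cE' s(u, w))
    rw [G.card_neighborFinset_eq_degree] at h1 h2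
    refine (Finset.card_union_le _ _).trans_lt ?_
    omega)
  simp only [Finset.mem_union, Finset.mem_image, SimpleGraph.mem_neighborFinset, not_or,
    not_exists, not_and] at hd
  obtain ⟨hdV, hdE⟩ := hd
  have hc_ne : ∀ e ∈ G.edgeSet, e ≠ s(u, v) → (∃ x, x ∈ s(u, v) ∧ x ∈ e) → cE e ≠ c := by
    rintro e he hne ⟨x, hx, hxe⟩
    obtain ⟨w, rfl⟩ := Sym2.mem_iff_exists.1 hxe
    rw [SimpleGraph.mem_edgeSet] at he
    rcases Sym2.mem_iff.1 hx with rfl | rfl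
    · exact hcu w (fun h => hne (by rw [h])) he
    · exact hcw w (fun h => hne (by rw [h, Sym2.eq_swap])) he
  refine ⟨Function.update cV u d, cE', ?_, ?_, ?_⟩
  · intro a b hab
    by_cases ha : a = u
    · subst ha
      rw [Function.update_self, Function.update_of_ne hab.ne']
      exact Ne.symm (hdV b hab)
    · by_cases hb : b = u
      · subst hb
        rw [Function.update_self, Function.update_of_ne ha]
        exact hdV a hab.symm
      · rw [Function.update_of_ne ha, Function.update_of_ne hb]
        refine hV a b ((hmem s(a, b)).2 ⟨hab, fun h => ?_⟩)
        rcases Sym2.mem_iff.1 (h ▸ Sym2.mem_mk_left u v : u ∈ s(a, b)) with h | h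
        · exact ha h.symm
        · exact hb h.symm
  · rintro e₁ h₁ e₂ h₂ hne ⟨x, hx₁, hx₂⟩
    by_cases he₁ : e₁ = s(u, v)
    · subst he₁
      rw [hcE'_self, hcE'_ne _ hne.symm]
      exact (hc_ne e₂ h₂ hne.symm ⟨x, hx₁, hx₂⟩).symm
    · by_cases he₂ : e₂ = s(u, v)
      · subst he₂
        rw [hcE'_self, hcE'_ne _ hne]
        exact hc_ne e₁ h₁ hne ⟨x, hx₂, hx₁⟩
      · rw [hcE'_ne _ he₁, hcE'_ne _ he₂]
        exact hE e₁ ((hmem _).2 ⟨h₁, he₁⟩) e₂ ((hmem _).2 ⟨h₂, he₂⟩) hne ⟨x, hx₁, hx₂⟩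
  · intro e he x hx
    by_cases hxu : x = u
    · subst hxu
      obtain ⟨w, rfl⟩ := Sym2.mem_iff_exists.1 hx
      rw [Function.update_self]
      exact hdE w he
    · rw [Function.update_of_ne hxu]
      by_cases hev : e = s(u, v)
      · subst hev
        obtain rfl := (Sym2.mem_iff.1 hx).resolve_left hxu
        rw [hcE'_self]
        exact hcv
      · rw [hcE'_ne _ hev]
        exact hVE e ((hmem _).2 ⟨he, hev⟩) x hx

/-- In an r-minimal graph (r ≥ 13), if uv is an edge with
d_G(u) ≤ ⌊r/2⌋, then d_G(u) + d_G(v) ≥ r + 3. -/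
theorem stmt_0 {V : Type*} [Fintype V] (r : ℕ) (hr : 13 ≤ r)
    (G : SimpleGraph V) [DecidableRel G.Adj] (hG : IsRMinimal r G)
    (u v : V) (huv : G.Adj u v) (hdu : G.degree u ≤ r / 2) :
    r + 3 ≤ G.degree u + G.degree v := by
  obtain ⟨-, -, hno, hdel⟩ := hG
  by_contra! hlt
  exact hno (.of_deleteEdges huv (by omega) (by omega) (hdel s(u, v) huv))
end

section
/- Let r ≥ 13 be an integer and let G be an r-minimal graph. If v is a vertex of G with d_G(v) = 3, then v is not contained in any triangle of G; that is, no two neighbors of v are adjacent to each other. -/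
/-- A total coloring of `G` in which the color of the vertex `v` is disregarded. -/
structure IsTotalColoringExcept {V C : Type*} (G : SimpleGraph V) (v : V) (cV : V → C)
    (cE : Sym2 V → C) : Prop where
  vertex : ∀ a b, G.Adj a b → a ≠ v → b ≠ v → cV a ≠ cV b
  edge : ∀ a b c, G.Adj a b → G.Adj a c → b ≠ c → cE s(a, b) ≠ cE s(a, c)
  incident : ∀ a b, G.Adj a b → a ≠ v → cE s(a, b) ≠ cV a

namespace IsTotalColoringExcept

variable {V C : Type*} {G G' : SimpleGraph V} {v : V} {cV : V → C} {cE : Sym2 V → C}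

open Classical in
/-- Coloring (or recoloring) a single edge `s(a, b)` with a color that is free at both ends. -/
theorem update (h : IsTotalColoringExcept G v cV cE) (a b : V) (c : C)
    (hG' : ∀ u w, G'.Adj u w → G.Adj u w ∨ s(u, w) = s(a, b))
    (hV : ∀ u w, G'.Adj u w → u ≠ v → w ≠ v → cV u ≠ cV w)
    (ha : a ≠ v → c ≠ cV a) (hb : b ≠ v → c ≠ cV b)
    (ha' : ∀ z, G.Adj a z → z ≠ b → cE s(a, z) ≠ c)
    (hb' : ∀ z, G.Adj b z → z ≠ a → cE s(b, z) ≠ c) :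
    IsTotalColoringExcept G' v cV (Function.update cE s(a, b) c) where
  vertex := hV
  edge := by
    have key : ∀ u w z, s(u, w) = s(a, b) → G'.Adj u z → s(u, z) ≠ s(a, b) →
        c ≠ cE s(u, z) := by
      intro u w z h1 h2 h3
      have h4 := (hG' u z h2).resolve_right h3
      rcases Sym2.eq_iff.1 h1 with ⟨rfl, rfl⟩ | ⟨rfl, rfl⟩
      · exact (ha' z h4 fun e => h3 (by rw [e])).symm
      · exact (hb' z h4 fun e => h3 (by rw [e, Sym2.eq_swap])).symm
    intro u w z h1 h2 h3
    by_cases e1 : s(u, w) = s(a, b) <;> by_cases e2 : s(u, z) = s(a, b)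
    · exact absurd (Sym2.congr_right.1 (e1.trans e2.symm)) h3
    · rw [e1, Function.update_self, Function.update_of_ne e2]
      exact key u w z e1 h2 e2
    · rw [e2, Function.update_self, Function.update_of_ne e1]
      exact (key u z w e2 h1 e1).symm
    · rw [Function.update_of_ne e1, Function.update_of_ne e2]
      exact h.edge u w z ((hG' _ _ h1).resolve_right e1) ((hG' _ _ h2).resolve_right e2) h3
  incident := by
    intro u w h1 h2
    by_cases e1 : s(u, w) = s(a, b)
    · rw [e1, Function.update_self]
      rcases Sym2.eq_iff.1 e1 with ⟨rfl, rfl⟩ | ⟨rfl, rfl⟩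
      · exact ha h2
      · exact hb h2
    · rw [Function.update_of_ne e1]
      exact h.incident u w ((hG' _ _ h1).resolve_right e1) h2

open Classical in
/-- If `v` has small degree, then it can be colored last. -/
theorem hasTotalColoring [Fintype V] [DecidableRel G.Adj] {k : ℕ} {cV : V → Fin k}
    {cE : Sym2 V → Fin k} (h : IsTotalColoringExcept G v cV cE) (hk : 2 * G.degree v < k) :
    HasTotalColoring G k := by
  set S : Finset (Fin k) := (G.neighborFinset v).image cV ∪
    (G.neighborFinset v).image (fun u => cE s(v, u)) with hS
  obtain ⟨c, hc⟩ : ∃ c, c ∉ S := by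
    by_contra! hall
    have h1 : S.card = k := by
      rw [Finset.eq_univ_iff_forall.2 hall, Finset.card_univ, Fintype.card_fin]
    have h2 := Finset.card_union_le ((G.neighborFinset v).image cV)
      ((G.neighborFinset v).image (fun u => cE s(v, u)))
    have h3 := Finset.card_image_le (s := G.neighborFinset v) (f := cV)
    have h4 := Finset.card_image_le (s := G.neighborFinset v) (f := fun u => cE s(v, u))
    rw [← hS] at h2
    rw [G.card_neighborFinset_eq_degree] at h3 h4
    omega
  have hcV : ∀ u, G.Adj v u → cV u ≠ c := fun u hu e => hc <|
    Finset.mem_union_left _ (Finset.mem_image.2 ⟨u, (G.mem_neighborFinset v u).2 hu, e⟩)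
  have hcE : ∀ u, G.Adj v u → cE s(v, u) ≠ c := fun u hu e => hc <|
    Finset.mem_union_right _ (Finset.mem_image.2 ⟨u, (G.mem_neighborFinset v u).2 hu, e⟩)
  refine ⟨Function.update cV v c, cE, ?_, ?_, ?_⟩
  · intro a b hab
    by_cases ha : a = v
    · subst ha
      rw [Function.update_self, Function.update_of_ne hab.ne']
      exact (hcV b hab).symm
    · by_cases hb : b = v
      · subst hb
        rw [Function.update_self, Function.update_of_ne ha]
        exact hcV a hab.symm
      · rw [Function.update_of_ne ha, Function.update_of_ne hb]
        exact h.vertex a b hab ha hb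
  · rintro e₁ h1 e₂ h2 hne ⟨a, ha1, ha2⟩
    obtain ⟨b, rfl⟩ := Sym2.mem_iff_exists.1 ha1
    obtain ⟨d, rfl⟩ := Sym2.mem_iff_exists.1 ha2
    exact h.edge a b d h1 h2 fun e => hne (by rw [e])
  · intro e he a ha
    obtain ⟨b, rfl⟩ := Sym2.mem_iff_exists.1 ha
    by_cases hav : a = v
    · subst hav
      rw [Function.update_self]
      exact hcE b he
    · rw [Function.update_of_ne hav]
      exact h.incident a b he hav

end IsTotalColoringExcept

/-- In an r-minimal graph (r ≥ 13), a vertex of degree 3 is contained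
in no triangle: no two of its neighbors are adjacent. -/
theorem stmt_2 {V : Type*} [Fintype V] (r : ℕ) (hr : 13 ≤ r)
    (G : SimpleGraph V) [DecidableRel G.Adj] (hG : IsRMinimal r G)
    (v : V) (hv : G.degree v = 3) :
    ∀ x y : V, G.Adj v x → G.Adj v y → ¬ G.Adj x y := by
  classical
  intro x y hvx hvy hxy
  obtain ⟨-, hmax, hno, hdel⟩ := hG
  have hdeg : ∀ u, G.degree u ≤ r := fun u => (G.degree_le_maxDegree u).trans hmax
  obtain ⟨cV, cE, hV, hE, hI⟩ := hdel s(v, x) hvx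
  set H := G.deleteEdges {s(v, x)} with hH
  have hHG : ∀ a b, H.Adj a b ↔ G.Adj a b ∧ s(a, b) ≠ s(v, x) := by
    intro a b
    simp [hH, SimpleGraph.deleteEdges_adj]
  have hcol : IsTotalColoringExcept H v cV cE :=
    ⟨fun a b h _ _ => hV a b h,
      fun a b c h1 h2 h3 => hE _ h1 _ h2 (fun e => h3 (Sym2.congr_right.1 e))
        ⟨a, Sym2.mem_mk_left _ _, Sym2.mem_mk_left _ _⟩,
      fun a b h _ => hI _ h a (Sym2.mem_mk_left _ _)⟩
  have hGV : ∀ a b, G.Adj a b → a ≠ v → b ≠ v → cV a ≠ cV b := by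
    intro a b h ha hb
    refine hV a b ((hHG a b).2 ⟨h, fun e => ?_⟩)
    rcases Sym2.eq_iff.1 e with ⟨e, -⟩ | ⟨-, e⟩
    exacts [ha e, hb e]
  have hadd : ∀ u w, G.Adj u w → H.Adj u w ∨ s(u, w) = s(v, x) := by
    intro u w h
    rw [hHG]
    tauto
  have hfin : ∀ cE', ¬ IsTotalColoringExcept G v cV cE' :=
    fun cE' h => hno (h.hasTotalColoring (by omega))
  obtain ⟨w, hw⟩ : ∃ w, ((G.neighborFinset v).erase x).erase y = {w} := by
    rw [← Finset.card_eq_one, Finset.card_erase_of_mem, Finset.card_erase_of_mem,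
      G.card_neighborFinset_eq_degree, hv]
    · simpa using hvx
    · simpa [hxy.ne'] using hvy
  have hvH : ∀ z, H.Adj v z → z = y ∨ z = w := by
    intro z hz
    obtain ⟨h1, h2⟩ := (hHG v z).1 hz
    by_contra! hcon
    have : z ∈ ((G.neighborFinset v).erase x).erase y := by
      simp only [Finset.mem_erase, SimpleGraph.mem_neighborFinset]
      exact ⟨hcon.1, fun e => h2 (by rw [e]), h1⟩
    rw [hw, Finset.mem_singleton] at this
    exact hcon.2 this
  have hwH : G.Adj v w ∧ w ≠ x ∧ w ≠ y := by
    have : w ∈ ((G.neighborFinset v).erase x).erase y := by simp [hw]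
    simp only [Finset.mem_erase, SimpleGraph.mem_neighborFinset] at this
    exact ⟨this.2.2, this.2.1, this.1⟩
  have hHvy : H.Adj v y := (hHG v y).2 ⟨hvy, fun e => hxy.ne' (Sym2.congr_right.1 e)⟩
  have hHvw : H.Adj v w := (hHG v w).2 ⟨hwH.1, fun e => hwH.2.1 (Sym2.congr_right.1 e)⟩
  have hHxy : H.Adj x y := (hHG x y).2 ⟨hxy, fun e => by
    rcases Sym2.eq_iff.1 e with ⟨e, -⟩ | ⟨-, e⟩
    exacts [hvx.ne e.symm, hvy.ne e.symm]⟩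
  have hHx : ∀ z, H.Adj x z → z ≠ v := fun z hz e => by
    refine ((hHG x z).1 hz).2 ?_
    rw [e, Sym2.eq_swap]
  set p := cE s(v, y) with hp
  set q := cE s(v, w) with hq
  have hpq : p ≠ q := hcol.edge v y w hHvy hHvw hwH.2.2.symm
  -- `U` is the set of colors present at `x`
  set U : Finset (Fin (r + 2)) :=
    insert (cV x) (((G.neighborFinset x).erase v).image fun z => cE s(x, z)) with hU
  have hUcard : U.card ≤ r := by
    have h1 := Finset.card_insert_le (cV x)
      (((G.neighborFinset x).erase v).image fun z => cE s(x, z))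
    rw [← hU] at h1
    have h2 := Finset.card_image_le (s := (G.neighborFinset x).erase v)
      (f := fun z => cE s(x, z))
    rw [Finset.card_erase_of_mem (by simpa using hvx.symm), G.card_neighborFinset_eq_degree] at h2
    have h3 := hdeg x
    omega
  have hfree : ∀ c, c ∉ U → c ≠ cV x ∧ ∀ z, H.Adj x z → cE s(x, z) ≠ c := by
    intro c hc
    refine ⟨fun e => hc (by simp [hU, e]), fun z hz e => hc ?_⟩
    refine Finset.mem_insert_of_mem (Finset.mem_image.2 ⟨z, ?_, e⟩)
    simpa using ⟨hHx z hz, ((hHG x z).1 hz).1⟩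
  have hall : ∀ c, c ≠ p → c ≠ q → c ∈ U := by
    intro c h1 h2
    by_contra hc
    obtain ⟨h3, h4⟩ := hfree c hc
    refine hfin _ (hcol.update v x c hadd hGV (fun h => absurd rfl h) (fun _ => h3) ?_
      (fun z hz _ => h4 z hz))
    intro z hz _
    rcases hvH z hz with rfl | rfl
    exacts [h1.symm, h2.symm]
  have huniv : insert p (insert q U) = Finset.univ := by
    refine Finset.eq_univ_iff_forall.2 fun c => ?_
    have := hall c
    simp only [Finset.mem_insert]
    tauto
  have hcard : (insert p (insert q U)).card = r + 2 := by
    rw [huniv, Finset.card_univ, Fintype.card_fin]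
  have hpU : p ∉ U := fun h => by
    rw [Finset.insert_eq_of_mem (Finset.mem_insert_of_mem h)] at hcard
    have := Finset.card_insert_le q U
    omega
  have hqU : q ∉ U := fun h => by
    rw [Finset.insert_eq_of_mem h] at hcard
    have := Finset.card_insert_le p U
    omega
  obtain ⟨hpx, hpx'⟩ := hfree p hpU
  obtain ⟨hqx, hqx'⟩ := hfree q hqU
  -- `m` is a color missing at `y`
  obtain ⟨m, hm⟩ : ∃ m, m ∉ insert (cV y) ((G.neighborFinset y).image fun z => cE s(y, z)) := by
    by_contra! hcon
    have h0 := congrArg Finset.card (Finset.eq_univ_iff_forall.2 hcon)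
    rw [Finset.card_univ, Fintype.card_fin] at h0
    have h1 := Finset.card_insert_le (cV y) ((G.neighborFinset y).image fun z => cE s(y, z))
    have h2 := Finset.card_image_le (s := G.neighborFinset y) (f := fun z => cE s(y, z))
    rw [G.card_neighborFinset_eq_degree] at h2
    have h3 := hdeg y
    omega
  have hmy : m ≠ cV y := fun e => hm (by simp [e])
  have hmy' : ∀ z, G.Adj y z → cE s(y, z) ≠ m := fun z hz e =>
    hm (Finset.mem_insert_of_mem (Finset.mem_image.2 ⟨z, by simpa using hz, e⟩))
  have hmp : p ≠ m := by
    have := hmy' v hvy.symm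
    rwa [Sym2.eq_swap] at this
  have hvxy : s(v, y) ≠ s(x, y) := fun e => hvx.ne (Sym2.congr_left.1 e)
  have hvwxy : s(v, w) ≠ s(x, y) := fun e => by
    rcases Sym2.eq_iff.1 e with ⟨e, -⟩ | ⟨e, -⟩
    exacts [hvx.ne e, hvy.ne e]
  by_cases hmq : m = q
  · -- recolor `xy` with `q` and give its old color to `vx`
    subst hmq
    have h1 := hcol.update (G' := H) x y (cE s(v, w)) (fun _ _ h => Or.inl h) hcol.vertex
      (fun _ => hqx) (fun _ => hmy) (fun z hz _ => hqx' z hz)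
      (fun z hz _ => hmy' z ((hHG y z).1 hz).1)
    refine hfin _ (h1.update v x (cE s(x, y)) hadd hGV (fun h => absurd rfl h)
      (hcol.incident x y hHxy) ?_ ?_)
    · intro z hz _
      rcases hvH z hz with rfl | rfl
      · rw [Function.update_of_ne hvxy, Sym2.eq_swap, Sym2.eq_swap (a := x)]
        exact hcol.edge _ _ _ hHvy.symm hHxy.symm hvx.ne
      · rw [Function.update_of_ne hvwxy]
        exact (hqx' y hHxy).symm
    · intro z hz _
      by_cases hzy : z = y
      · rw [hzy, Function.update_self]
        exact (hqx' y hHxy).symm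
      · rw [Function.update_of_ne fun e => hzy (Sym2.congr_right.1 e)]
        exact hcol.edge _ _ _ hz hHxy hzy
  · -- recolor `vy` with `m` and give its old color to `vx`
    have h1 := hcol.update (G' := H) v y m (fun _ _ h => Or.inl h) hcol.vertex
      (fun h => absurd rfl h) (fun _ => hmy)
      (fun z hz hzy => by
        rcases hvH z hz with rfl | rfl
        exacts [absurd rfl hzy, Ne.symm hmq])
      (fun z hz _ => hmy' z ((hHG y z).1 hz).1)
    refine hfin _ (h1.update v x p hadd hGV (fun h => absurd rfl h) (fun _ => hpx) ?_ ?_)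
    · intro z hz _
      rcases hvH z hz with rfl | rfl
      · rw [Function.update_self]
        exact hmp.symm
      · rw [Function.update_of_ne fun e => hwH.2.2 (Sym2.congr_right.1 e)]
        exact hpq.symm
    · intro z hz _
      rw [Function.update_of_ne]
      · exact hpx' z hz
      · intro e
        rcases Sym2.eq_iff.1 e with ⟨e, -⟩ | ⟨e, -⟩
        exacts [hvx.ne e.symm, hxy.ne e]
end

section
/- Let r ≥ 13 be an integer and let G be an r-minimal graph. If v is a vertex of G with d_G(v) = 4 and u is any neighbor of v, then the edge uv is not contained in two triangles of G; that is, there do not exist two distinct common neighbors of u and v. -/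
/-- `F` is a partial proper edge coloring (`none` meaning uncolored), and no edge at a vertex
other than `v` has the color that `c` gives to this vertex. -/
structure IsPartialColoring {V K : Type*} (c : V → K) (v : V) (F : V → V → Option K) : Prop where
  symm : ∀ a b, F a b = F b a
  proper : ∀ a b b' m, F a b = some m → F a b' = some m → b = b'
  avoid : ∀ a b, a ≠ v → F a b ≠ some (c a)

/-- The color `m` is used neither on the vertex `y` nor on an edge at `y`. -/
def IsMissing {V K : Type*} (c : V → K) (F : V → V → Option K) (y : V) (m : K) : Prop :=
  m ≠ c y ∧ ∀ z, F y z ≠ some m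

/-- The edge `vu` can be colored without losing any other edge. -/
def IsFillable {V K : Type*} (c : V → K) (v u : V) (F : V → V → Option K) : Prop :=
  ∃ F', IsPartialColoring c v F' ∧ F' v u ≠ none ∧ ∀ a b, F a b ≠ none → F' a b ≠ none

open Classical in
/-- Give the edge `ab` the (possibly empty) color `o`. -/
noncomputable def recolorEdge {V K : Type*} (F : V → V → Option K) (a b : V) (o : Option K) :
    V → V → Option K :=
  fun x y => if (x = a ∧ y = b) ∨ (x = b ∧ y = a) then o else F x y

theorem IsPartialColoring.erase {V K : Type*} {c : V → K} {v : V} {F : V → V → Option K}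
    (h : IsPartialColoring c v F) (a b : V) : IsPartialColoring c v (recolorEdge F a b none) := by
  obtain ⟨h1, h2, h3⟩ := h
  refine ⟨?_, ?_, ?_⟩ <;> simp only [recolorEdge] <;> grind

theorem IsPartialColoring.recolor {V K : Type*} {c : V → K} {v : V} {F : V → V → Option K}
    (h : IsPartialColoring c v F) {a b : V} {m : K} (hab : a ≠ b)
    (ha : ∀ y, y ≠ b → F a y ≠ some m) (hb : ∀ y, y ≠ a → F b y ≠ some m)
    (hca : a ≠ v → m ≠ c a) (hcb : b ≠ v → m ≠ c b) :
    IsPartialColoring c v (recolorEdge F a b (some m)) := by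
  obtain ⟨h1, h2, h3⟩ := h
  refine ⟨?_, ?_, ?_⟩ <;> simp only [recolorEdge] <;> grind

section

variable {V K : Type*} {c : V → K} {v u : V} {F : V → V → Option K}

theorem IsPartialColoring.fillable_of_shift (h : IsPartialColoring c v F) {y : V} (hvu : v ≠ u)
    (hyv : y ≠ v) {p m : K} (hp : IsMissing c F u p) (hvy : F v y = some p)
    (hm : IsMissing c F y m) (hmv : ∀ z, F v z ≠ some m) : IsFillable c v u F := by
  obtain ⟨hp, hp'⟩ := hp
  obtain ⟨hm, hm'⟩ := hm
  have h1 := h.symm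
  have h2 := h.proper
  have h3 := h.avoid
  have A := h.recolor (a := v) (b := y) (m := m) (by grind) (by grind) (by grind) (by grind)
    (by grind)
  have B := A.recolor (a := v) (b := u) (m := p) (by grind) (by grind [recolorEdge])
    (by grind [recolorEdge]) (by grind) (by grind)
  exact ⟨_, B, by grind [recolorEdge], by grind [recolorEdge]⟩

theorem IsPartialColoring.fillable_of_triangle (h : IsPartialColoring c v F) {y : V}
    (hvu : v ≠ u) (hyu : y ≠ u) {m α : K} (hp : IsMissing c F u m)
    (hm : IsMissing c F y m) (hα : F u y = some α) (hαv : ∀ z, F v z ≠ some α) :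
    IsFillable c v u F := by
  obtain ⟨hp, hp'⟩ := hp
  obtain ⟨hm, hm'⟩ := hm
  have h1 := h.symm
  have h2 := h.proper
  have h3 := h.avoid
  have A := h.recolor (a := u) (b := y) (m := m) (by grind) (by grind) (by grind) (by grind)
    (by grind)
  have B := A.recolor (a := v) (b := u) (m := α) (by grind) (by grind [recolorEdge])
    (by grind [recolorEdge]) (by grind) (by grind)
  exact ⟨_, B, by grind [recolorEdge], by grind [recolorEdge]⟩

/-- A partial coloring around a vertex `v` of degree four: the edge `vu` is uncolored, it lies in
the triangles `vuw₁` and `vuw₂`, and `x` is the fourth neighbor of `v`. -/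
structure IsDoubleTriangle (c : V → K) (v u w₁ w₂ x : V) (F : V → V → Option K)
    (i₁ i₂ i₃ : K) : Prop extends IsPartialColoring c v F where
  vu : v ≠ u
  vw₁ : v ≠ w₁
  vw₂ : v ≠ w₂
  vx : v ≠ x
  uw₁ : u ≠ w₁
  uw₂ : u ≠ w₂
  ux : u ≠ x
  w₁w₂ : w₁ ≠ w₂
  w₁x : w₁ ≠ x
  w₂x : w₂ ≠ x
  color_w₁ : F v w₁ = some i₁
  color_w₂ : F v w₂ = some i₂
  color_x : F v x = some i₃
  other : ∀ z, z ≠ w₁ → z ≠ w₂ → z ≠ x → F v z = none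
  triangle₁ : F u w₁ ≠ none
  triangle₂ : F u w₂ ≠ none

namespace IsDoubleTriangle

variable {w₁ w₂ x : V} {i₁ i₂ i₃ : K}

theorem swap (h : IsDoubleTriangle c v u w₁ w₂ x F i₁ i₂ i₃) :
    IsDoubleTriangle c v u w₂ w₁ x F i₂ i₁ i₃ where
  toIsPartialColoring := h.toIsPartialColoring
  vu := h.vu
  vw₁ := h.vw₂
  vw₂ := h.vw₁
  vx := h.vx
  uw₁ := h.uw₂
  uw₂ := h.uw₁
  ux := h.ux
  w₁w₂ := h.w₁w₂.symm
  w₁x := h.w₂x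
  w₂x := h.w₁x
  color_w₁ := h.color_w₂
  color_w₂ := h.color_w₁
  color_x := h.color_x
  other z h1 h2 h3 := h.other z h2 h1 h3
  triangle₁ := h.triangle₂
  triangle₂ := h.triangle₁

theorem ne (h : IsDoubleTriangle c v u w₁ w₂ x F i₁ i₂ i₃) : i₁ ≠ i₂ ∧ i₁ ≠ i₃ ∧ i₂ ≠ i₃ := by
  obtain ⟨⟨h1, h2, h3⟩, _, _, _, _, _, _, _, _, _, _, e₁, e₂, e₃, _, _, _⟩ := h
  grind

theorem fillable_of_cascade (h : IsDoubleTriangle c v u w₁ w₂ x F i₁ i₂ i₃)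
    {m : K} (hp : IsMissing c F u i₁)
    (h2' : IsMissing c F w₁ i₂) (hm : IsMissing c F w₂ m) (hmv : ∀ z, F v z ≠ some m) :
    IsFillable c v u F := by
  obtain ⟨n12, n13, n23⟩ := h.ne
  obtain ⟨h0, _, _, _, _, _, _, _, _, _, _, e₁, e₂, e₃, ho, t₁, t₂⟩ := h
  have h1 := h0.symm
  have h2 := h0.proper
  have h3 := h0.avoid
  unfold IsMissing at *
  have hA := h0.recolor (a := v) (b := w₂) (m := m) (by grind) (by grind [recolorEdge])
    (by grind [recolorEdge]) (by grind) (by grind)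
  have hB := hA.recolor (a := v) (b := w₁) (m := i₂) (by grind) (by grind [recolorEdge])
    (by grind [recolorEdge]) (by grind) (by grind)
  have hC := hB.recolor (a := v) (b := u) (m := i₁) (by grind) (by grind [recolorEdge])
    (by grind [recolorEdge]) (by grind) (by grind)
  exact ⟨_, hC, by grind [recolorEdge], by grind [recolorEdge]⟩

theorem fillable_of_release (h : IsDoubleTriangle c v u w₁ w₂ x F i₁ i₂ i₃)
    {m : K} (hp : IsMissing c F u i₃)
    (h3' : IsMissing c F w₁ i₃) (h2' : F u w₁ = some i₂) (hm : IsMissing c F w₂ m)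
    (hmv : ∀ z, F v z ≠ some m) :
    IsFillable c v u F := by
  obtain ⟨n12, n13, n23⟩ := h.ne
  obtain ⟨h0, _, _, _, _, _, _, _, _, _, _, e₁, e₂, e₃, ho, t₁, t₂⟩ := h
  have h1 := h0.symm
  have h2 := h0.proper
  have h3 := h0.avoid
  unfold IsMissing at *
  have hA := h0.recolor (a := v) (b := w₂) (m := m) (by grind) (by grind [recolorEdge])
    (by grind [recolorEdge]) (by grind) (by grind)
  have hB := hA.recolor (a := u) (b := w₁) (m := i₃) (by grind) (by grind [recolorEdge])
    (by grind [recolorEdge]) (by grind) (by grind)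
  have hC := hB.recolor (a := v) (b := u) (m := i₂) (by grind) (by grind [recolorEdge])
    (by grind [recolorEdge]) (by grind) (by grind)
  exact ⟨_, hC, by grind [recolorEdge], by grind [recolorEdge]⟩

theorem fillable_of_two_triangles (h : IsDoubleTriangle c v u w₁ w₂ x F i₁ i₂ i₃)
    {α : K} (hp : IsMissing c F u i₂)
    (h1' : IsMissing c F w₁ i₂) (h2' : IsMissing c F w₂ i₃) (hα₁ : F u w₁ = some i₃)
    (hα₂ : F u w₂ = some α) (hα : ∀ z, F v z ≠ some α) :
    IsFillable c v u F := by
  obtain ⟨n12, n13, n23⟩ := h.ne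
  obtain ⟨h0, _, _, _, _, _, _, _, _, _, _, e₁, e₂, e₃, ho, t₁, t₂⟩ := h
  have h1 := h0.symm
  have h2 := h0.proper
  have h3 := h0.avoid
  unfold IsMissing at *
  have hA := h0.recolor (a := u) (b := w₁) (m := i₂) (by grind) (by grind [recolorEdge])
    (by grind [recolorEdge]) (by grind) (by grind)
  have hB := hA.recolor (a := u) (b := w₂) (m := i₃) (by grind) (by grind [recolorEdge])
    (by grind [recolorEdge]) (by grind) (by grind)
  have hC := hB.recolor (a := v) (b := u) (m := α) (by grind) (by grind [recolorEdge])
    (by grind [recolorEdge]) (by grind) (by grind)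
  exact ⟨_, hC, by grind [recolorEdge], by grind [recolorEdge]⟩

theorem fillable_of_fourth (h : IsDoubleTriangle c v u w₁ w₂ x F i₁ i₂ i₃)
    {m : K} (hp : IsMissing c F u i₁)
    (h1' : IsMissing c F w₁ i₃) (hm : IsMissing c F x m) (hmv : ∀ z, F v z ≠ some m) :
    IsFillable c v u F := by
  obtain ⟨n12, n13, n23⟩ := h.ne
  obtain ⟨h0, _, _, _, _, _, _, _, _, _, _, e₁, e₂, e₃, ho, t₁, t₂⟩ := h
  have h1 := h0.symm
  have h2 := h0.proper
  have h3 := h0.avoid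
  unfold IsMissing at *
  have hA := h0.recolor (a := v) (b := x) (m := m) (by grind) (by grind [recolorEdge])
    (by grind [recolorEdge]) (by grind) (by grind)
  have hB := hA.recolor (a := v) (b := w₁) (m := i₃) (by grind) (by grind [recolorEdge])
    (by grind [recolorEdge]) (by grind) (by grind)
  have hC := hB.recolor (a := v) (b := u) (m := i₁) (by grind) (by grind [recolorEdge])
    (by grind [recolorEdge]) (by grind) (by grind)
  exact ⟨_, hC, by grind [recolorEdge], by grind [recolorEdge]⟩

theorem fillable_of_rotation (h : IsDoubleTriangle c v u w₁ w₂ x F i₁ i₂ i₃)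
    {α : K} (hp : IsMissing c F u i₁)
    (h1' : IsMissing c F w₁ i₃) (hx : IsMissing c F x i₁) (hα₁ : F u w₁ = some α)
    (hα : ∀ z, F v z ≠ some α) :
    IsFillable c v u F := by
  obtain ⟨n12, n13, n23⟩ := h.ne
  obtain ⟨h0, _, _, _, _, _, _, _, _, _, _, e₁, e₂, e₃, ho, t₁, t₂⟩ := h
  have h1 := h0.symm
  have h2 := h0.proper
  have h3 := h0.avoid
  unfold IsMissing at *
  have hA := h0.erase v w₁
  have hB := hA.recolor (a := v) (b := x) (m := i₁) (by grind) (by grind [recolorEdge])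
    (by grind [recolorEdge]) (by grind) (by grind)
  have hC := hB.recolor (a := v) (b := w₁) (m := i₃) (by grind) (by grind [recolorEdge])
    (by grind [recolorEdge]) (by grind) (by grind)
  have hD := hC.recolor (a := u) (b := w₁) (m := i₁) (by grind) (by grind [recolorEdge])
    (by grind [recolorEdge]) (by grind) (by grind)
  have hE := hD.recolor (a := v) (b := u) (m := α) (by grind) (by grind [recolorEdge])
    (by grind [recolorEdge]) (by grind) (by grind)
  exact ⟨_, hE, by grind [recolorEdge], by grind [recolorEdge]⟩

theorem notMem_colors (h : IsDoubleTriangle c v u w₁ w₂ x F i₁ i₂ i₃) {m : K} (h₁ : m ≠ i₁)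
    (h₂ : m ≠ i₂) (h₃ : m ≠ i₃) (z : V) : F v z ≠ some m := by
  obtain ⟨_, _, _, _, _, _, _, _, _, _, _, e₁, e₂, e₃, ho, t₁, t₂⟩ := h
  by_cases z = w₁ <;> by_cases z = w₂ <;> by_cases z = x <;> grind

theorem fillable_of_missing (h : IsDoubleTriangle c v u w₁ w₂ x F i₁ i₂ i₃) {m : K}
    (hm : IsMissing c F u m) (hmv : ∀ z, F v z ≠ some m) : IsFillable c v u F := by
  obtain ⟨h0, _, _, _, _, _, _, _, _, _, _, e₁, e₂, e₃, ho, t₁, t₂⟩ := h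
  have h1 := h0.symm
  unfold IsMissing at *
  have hA := h0.recolor (a := v) (b := u) (m := m) (by grind) (by grind) (by grind) (by grind)
    (by grind)
  exact ⟨_, hA, by grind [recolorEdge], by grind [recolorEdge]⟩

theorem fillable_of_missing_one_three (h : IsDoubleTriangle c v u w₁ w₂ x F i₁ i₂ i₃) {m₁ m₂ : K}
    (h₁ : IsMissing c F u i₁) (h₃ : IsMissing c F u i₃) (hm₁ : IsMissing c F w₁ m₁)
    (hm₂ : IsMissing c F w₂ m₂) : IsFillable c v u F := by
  obtain ⟨n12, n13, n23⟩ := h.ne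
  have hs := h.symm
  have m1n : m₁ ≠ i₁ := fun e => hm₁.2 v (by rw [hs, h.color_w₁, e])
  have m2n : m₂ ≠ i₂ := fun e => hm₂.2 v (by rw [hs, h.color_w₂, e])
  obtain ⟨α₁, hα₁⟩ := Option.ne_none_iff_exists'.1 h.triangle₁
  obtain ⟨α₂, hα₂⟩ := Option.ne_none_iff_exists'.1 h.triangle₂
  have a11 : α₁ ≠ i₁ := fun e => h₁.2 w₁ (by rw [hα₁, e])
  have a13 : α₁ ≠ i₃ := fun e => h₃.2 w₁ (by rw [hα₁, e])
  have a21 : α₂ ≠ i₁ := fun e => h₁.2 w₂ (by rw [hα₂, e])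
  have a23 : α₂ ≠ i₃ := fun e => h₃.2 w₂ (by rw [hα₂, e])
  have a22 : α₂ ≠ i₂ := fun e =>
    h.vu (h.proper w₂ v u i₂ (by rw [hs, h.color_w₂]) (by rw [hs, hα₂, e]))
  by_cases e21 : m₂ = i₁
  · exact h.fillable_of_triangle h.vu h.uw₂.symm h₁ (e21 ▸ hm₂) hα₂
      (h.notMem_colors a21 a22 a23)
  by_cases e23 : m₂ = i₃
  · exact h.fillable_of_triangle h.vu h.uw₂.symm h₃ (e23 ▸ hm₂) hα₂
      (h.notMem_colors a21 a22 a23)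
  have hm₂v := h.notMem_colors e21 m2n e23
  by_cases e12 : m₁ = i₂
  · exact h.fillable_of_cascade h₁ (e12 ▸ hm₁) hm₂ hm₂v
  by_cases e13 : m₁ = i₃
  · by_cases a12 : α₁ = i₂
    · exact h.fillable_of_release h₃ (e13 ▸ hm₁) (a12 ▸ hα₁) hm₂ hm₂v
    · exact h.fillable_of_triangle h.vu h.uw₁.symm h₃ (e13 ▸ hm₁) hα₁
        (h.notMem_colors a11 a12 a13)
  · exact h.fillable_of_shift h.vu h.vw₁.symm h₁ h.color_w₁ hm₁
      (h.notMem_colors m1n e12 e13)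

theorem fillable_of_missing_one_two (h : IsDoubleTriangle c v u w₁ w₂ x F i₁ i₂ i₃)
    {m₁ m₂ m₃ : K} (h₁ : IsMissing c F u i₁) (h₂ : IsMissing c F u i₂)
    (hm₁ : IsMissing c F w₁ m₁) (hm₂ : IsMissing c F w₂ m₂) (hm₃ : IsMissing c F x m₃) :
    IsFillable c v u F := by
  obtain ⟨n12, n13, n23⟩ := h.ne
  have hs := h.symm
  have m1n : m₁ ≠ i₁ := fun e => hm₁.2 v (by rw [hs, h.color_w₁, e])
  have m2n : m₂ ≠ i₂ := fun e => hm₂.2 v (by rw [hs, h.color_w₂, e])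
  have m3n : m₃ ≠ i₃ := fun e => hm₃.2 v (by rw [hs, h.color_x, e])
  obtain ⟨α₁, hα₁⟩ := Option.ne_none_iff_exists'.1 h.triangle₁
  obtain ⟨α₂, hα₂⟩ := Option.ne_none_iff_exists'.1 h.triangle₂
  have a11 : α₁ ≠ i₁ := fun e => h₁.2 w₁ (by rw [hα₁, e])
  have a12 : α₁ ≠ i₂ := fun e => h₂.2 w₁ (by rw [hα₁, e])
  have a21 : α₂ ≠ i₁ := fun e => h₁.2 w₂ (by rw [hα₂, e])
  have a22 : α₂ ≠ i₂ := fun e => h₂.2 w₂ (by rw [hα₂, e])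
  have a33 : α₁ = i₃ → α₂ ≠ i₃ := fun e e' =>
    h.w₁w₂ (h.proper u w₁ w₂ i₃ (by rw [hα₁, e]) (by rw [hα₂, e']))
  have b1 : m₁ = i₃ → α₁ ≠ i₃ := fun e e' => hm₁.2 u (by rw [hs, hα₁, e, e'])
  have b2 : m₂ = i₃ → α₂ ≠ i₃ := fun e e' => hm₂.2 u (by rw [hs, hα₂, e, e'])
  by_cases c1 : m₁ = i₂ ∨ m₁ = i₃
  swap
  · exact h.fillable_of_shift h.vu h.vw₁.symm h₁ h.color_w₁ hm₁
      (h.notMem_colors m1n (by tauto) (by tauto))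
  by_cases c2 : m₂ = i₁ ∨ m₂ = i₃
  swap
  · exact h.fillable_of_shift h.vu h.vw₂.symm h₂ h.color_w₂ hm₂
      (h.notMem_colors (by tauto) m2n (by tauto))
  rcases c1 with c1 | c1
  · by_cases a13 : α₁ = i₃
    swap
    · exact h.fillable_of_triangle h.vu h.uw₁.symm h₂ (c1 ▸ hm₁) hα₁
        (h.notMem_colors a11 a12 a13)
    have hα₂v := h.notMem_colors a21 a22 (a33 a13)
    rcases c2 with c2 | c2
    · exact h.fillable_of_triangle h.vu h.uw₂.symm h₁ (c2 ▸ hm₂) hα₂ hα₂v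
    · exact h.fillable_of_two_triangles h₂ (c1 ▸ hm₁) (c2 ▸ hm₂) (a13 ▸ hα₁) hα₂ hα₂v
  have hα₁v := h.notMem_colors a11 a12 (b1 c1)
  rcases c2 with c2 | c2
  · by_cases a23 : α₂ = i₃
    · exact h.swap.fillable_of_two_triangles h₁ (c2 ▸ hm₂) (c1 ▸ hm₁) (a23 ▸ hα₂) hα₁ hα₁v
    · exact h.fillable_of_triangle h.vu h.uw₂.symm h₁ (c2 ▸ hm₂) hα₂
        (h.notMem_colors a21 a22 a23)
  by_cases e1 : m₃ = i₁
  · exact h.fillable_of_rotation h₁ (c1 ▸ hm₁) (e1 ▸ hm₃) hα₁ hα₁v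
  by_cases e2 : m₃ = i₂
  · exact h.swap.fillable_of_rotation h₂ (c2 ▸ hm₂) (e2 ▸ hm₃) hα₂
      (h.notMem_colors a21 a22 (b2 c2))
  exact h.fillable_of_fourth h₁ (c1 ▸ hm₁) hm₃ (h.notMem_colors e1 e2 m3n)

theorem fillable (h : IsDoubleTriangle c v u w₁ w₂ x F i₁ i₂ i₃) {p q m₁ m₂ m₃ : K} (hpq : p ≠ q)
    (hp : IsMissing c F u p) (hq : IsMissing c F u q) (hm₁ : IsMissing c F w₁ m₁)
    (hm₂ : IsMissing c F w₂ m₂) (hm₃ : IsMissing c F x m₃) : IsFillable c v u F := by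
  by_cases cp : p = i₁ ∨ p = i₂ ∨ p = i₃
  swap
  · exact h.fillable_of_missing hp (h.notMem_colors (by tauto) (by tauto) (by tauto))
  by_cases cq : q = i₁ ∨ q = i₂ ∨ q = i₃
  swap
  · exact h.fillable_of_missing hq (h.notMem_colors (by tauto) (by tauto) (by tauto))
  rcases cp with rfl | rfl | rfl <;> rcases cq with rfl | rfl | rfl
  · exact absurd rfl hpq
  · exact h.fillable_of_missing_one_two hp hq hm₁ hm₂ hm₃
  · exact h.fillable_of_missing_one_three hp hq hm₁ hm₂
  · exact h.fillable_of_missing_one_two hq hp hm₁ hm₂ hm₃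
  · exact absurd rfl hpq
  · exact h.swap.fillable_of_missing_one_three hp hq hm₂ hm₁
  · exact h.fillable_of_missing_one_three hq hp hm₁ hm₂
  · exact h.swap.fillable_of_missing_one_three hq hp hm₂ hm₁
  · exact absurd rfl hpq

end IsDoubleTriangle

end

theorem hasTotalColoring_of_isPartialColoring {V : Type*} [Fintype V] {k : ℕ} {G : SimpleGraph V}
    [DecidableRel G.Adj] {c : V → Fin k} {v : V} {F : V → V → Option (Fin k)}
    (h : IsPartialColoring c v F) (hF : ∀ a b, G.Adj a b → F a b ≠ none)
    (hc : ∀ a b, a ≠ v → b ≠ v → G.Adj a b → c a ≠ c b) (hv : 2 * G.degree v < k) :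
    HasTotalColoring G k := by
  classical
  let E : V → V → Fin k := fun a b => (F a b).getD ⟨0, by omega⟩
  have hE : ∀ a b, G.Adj a b → F a b = some (E a b) := by
    intro a b hab
    obtain ⟨m, hm⟩ := Option.ne_none_iff_exists'.1 (hF a b hab)
    simp [E, hm]
  have hEs : ∀ a b, E a b = E b a := fun a b => by simp only [E, h.symm a b]
  obtain ⟨m, hm⟩ : ∃ m, m ∉ (G.neighborFinset v).image c ∪ (G.neighborFinset v).image (E v) := by
    by_contra! hall
    have h1 := Finset.card_le_card (fun m _ => hall m : (Finset.univ : Finset (Fin k)) ⊆ _)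
    have h2 := Finset.card_union_le ((G.neighborFinset v).image c)
      ((G.neighborFinset v).image (E v))
    have h3 := Finset.card_image_le (s := G.neighborFinset v) (f := c)
    have h4 := Finset.card_image_le (s := G.neighborFinset v) (f := E v)
    rw [Finset.card_univ, Fintype.card_fin] at h1
    rw [G.card_neighborFinset_eq_degree] at h3 h4
    omega
  simp only [Finset.mem_union, Finset.mem_image, SimpleGraph.mem_neighborFinset, not_or,
    not_exists, not_and] at hm
  refine ⟨Function.update c v m, Sym2.lift ⟨E, hEs⟩, ?_, ?_, ?_⟩
  · intro a b hab
    have := hab.ne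
    have := hab.symm
    simp only [Function.update_apply]
    grind
  · rintro e₁ he₁ e₂ he₂ hne ⟨y, ⟨z₁, rfl⟩, ⟨z₂, rfl⟩⟩ heq
    simp only [Sym2.lift_mk] at heq
    exact hne (by rw [h.proper y z₁ z₂ _ (hE _ _ he₁) (heq ▸ hE _ _ he₂)])
  · rintro e he y ⟨z, rfl⟩
    simp only [Sym2.lift_mk, Function.update_apply]
    have hz := hE y z he
    have h3 := h.avoid y z
    have hyz : G.Adj y z := he
    split_ifs with hy
    · subst hy
      exact hm.2 z hyz
    · exact fun e => h3 hy (by rw [hz, e])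

/-- If few edges at `y` are colored, then many colors are missing at `y`. -/
theorem exists_isMissing {V : Type*} {k : ℕ} {c : V → Fin k}
    {F : V → V → Option (Fin k)} {y : V} (S : Finset V) (hS : ∀ z, z ∉ S → F y z = none)
    (T : Finset (Fin k)) (hk : S.card + 1 + T.card < k) : ∃ m, IsMissing c F y m ∧ m ∉ T := by
  classical
  by_contra! hall
  have hsub : (Finset.univ : Finset (Fin k)) ⊆
      (S.image fun z => (F y z).getD ⟨0, by omega⟩) ∪ {c y} ∪ T := by
    intro m _
    have hm := hall m
    unfold IsMissing at hm
    simp only [Finset.mem_union, Finset.mem_image, Finset.mem_singleton]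
    by_contra! hcon
    obtain ⟨⟨h1, h2⟩, h3⟩ := hcon
    refine h3 (hm ⟨h2, fun z hz => ?_⟩)
    by_cases hzS : z ∈ S
    · exact h1 z hzS (by simp [hz])
    · simp [hS z hzS] at hz
  have h1 := Finset.card_le_card hsub
  have h2 := Finset.card_union_le ((S.image fun z => (F y z).getD ⟨0, by omega⟩) ∪ {c y}) T
  have h3 := Finset.card_union_le (S.image fun z => (F y z).getD ⟨0, by omega⟩) {c y}
  have h4 := Finset.card_image_le (s := S) (f := fun z => (F y z).getD ⟨0, by omega⟩)
  rw [Finset.card_univ, Fintype.card_fin] at h1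
  rw [Finset.card_singleton] at h3
  omega

/-- In an r-minimal graph (r ≥ 13), if v has degree 4 and u is a
neighbor of v, then the edge uv lies in at most one triangle: there are no two
distinct common neighbors of u and v. -/
theorem stmt_3 {V : Type*} [Fintype V] (r : ℕ) (hr : 13 ≤ r)
    (G : SimpleGraph V) [DecidableRel G.Adj] (hG : IsRMinimal r G)
    (v u : V) (hv : G.degree v = 4) (huv : G.Adj u v) :
    ¬ ∃ w₁ w₂ : V, w₁ ≠ w₂ ∧ G.Adj u w₁ ∧ G.Adj v w₁ ∧ G.Adj u w₂ ∧ G.Adj v w₂ := by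
  classical
  rintro ⟨w₁, w₂, hw, huw₁, hvw₁, huw₂, hvw₂⟩
  obtain ⟨-, hΔ, hno, hdel⟩ := hG
  apply hno
  obtain ⟨c, cE, hc, hE, hcE⟩ := hdel s(u, v) huv
  have hdeg : ∀ y, G.degree y ≤ r := fun y => (G.degree_le_maxDegree y).trans hΔ
  obtain ⟨x, hx⟩ : ∃ x, G.neighborFinset v = {u, w₁, w₂, x} ∧ x ∉ ({u, w₁, w₂} : Finset V) := by
    have h3 : ({u, w₁, w₂} : Finset V).card = 3 :=
      Finset.card_eq_three.2 ⟨u, w₁, w₂, huw₁.ne, huw₂.ne, hw, rfl⟩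
    have hsub : ({u, w₁, w₂} : Finset V) ⊆ G.neighborFinset v := by
      intro z
      simp only [Finset.mem_insert, Finset.mem_singleton, SimpleGraph.mem_neighborFinset]
      rintro (rfl | rfl | rfl)
      exacts [huv.symm, hvw₁, hvw₂]
    have h1 : (G.neighborFinset v \ {u, w₁, w₂}).card = 1 := by
      rw [Finset.card_sdiff_of_subset hsub, G.card_neighborFinset_eq_degree, hv, h3]
    obtain ⟨x, hx⟩ := Finset.card_eq_one.1 h1
    refine ⟨x, ?_, (Finset.mem_sdiff.1 (hx ▸ Finset.mem_singleton_self x)).2⟩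
    rw [← Finset.union_sdiff_of_subset hsub, hx]
    ext z
    simp only [Finset.mem_union, Finset.mem_insert, Finset.mem_singleton]
    tauto
  obtain ⟨hN, hx⟩ := hx
  have hN' : ∀ z, G.Adj v z ↔ z = u ∨ z = w₁ ∨ z = w₂ ∨ z = x := by
    intro z
    rw [← SimpleGraph.mem_neighborFinset, hN]
    simp
  simp only [Finset.mem_insert, Finset.mem_singleton, not_or] at hx
  have hvx : G.Adj v x := (hN' x).2 (by simp)
  set H := G.deleteEdges {s(u, v)} with hH
  have hHa : ∀ a b, H.Adj a b ↔ G.Adj a b ∧ ¬((a = u ∧ b = v) ∨ (a = v ∧ b = u)) := by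
    intro a b
    simp [hH, SimpleGraph.deleteEdges_adj]
  let F : V → V → Option (Fin (r + 2)) := fun a b => if H.Adj a b then some (cE s(a, b)) else none
  have hF : IsPartialColoring c v F := by
    refine ⟨?_, ?_, ?_⟩
    · intro a b
      simp only [F, H.adj_comm a b, Sym2.eq_swap (a := a)]
    · intro a b b' m h1 h2
      simp only [F, Option.ite_none_right_eq_some, Option.some.injEq] at h1 h2
      by_contra hne
      refine hE s(a, b) h1.1 s(a, b') h2.1 (mt Sym2.congr_right.1 hne) ⟨a, by simp, by simp⟩ ?_
      rw [h1.2, h2.2]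
    · intro a b _ h1
      simp only [F, Option.ite_none_right_eq_some, Option.some.injEq] at h1
      exact hcE s(a, b) h1.1 a (by simp) h1.2
  have hFn : ∀ a b, F a b ≠ none ↔ H.Adj a b := by
    intro a b
    simp [F]
  have hFv : ∀ z, H.Adj v z → F v z = some (cE s(v, z)) := fun z hz => if_pos hz
  have hD : IsDoubleTriangle c v u w₁ w₂ x F (cE s(v, w₁)) (cE s(v, w₂)) (cE s(v, x)) := by
    have := huv.ne
    have := huw₁.ne
    have := huw₂.ne
    have := hvw₁.ne
    have := hvw₂.ne
    have := hvx.ne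
    refine ⟨hF, by grind, by grind, by grind, by grind, by grind, by grind, by grind, by grind,
      by grind, by grind, hFv _ ?_, hFv _ ?_, hFv _ ?_, ?_, ?_, ?_⟩
    · grind
    · grind
    · grind
    · intro z h1 h2 h3
      by_contra hz
      rw [← ne_eq, hFn, hHa, hN'] at hz
      grind
    · rw [hFn, hHa]
      grind
    · rw [hFn, hHa]
      grind
  have hmiss : ∀ y, ∃ m, IsMissing c F y m := by
    intro y
    obtain ⟨m, hm, -⟩ := exists_isMissing (c := c) (F := F) (y := y) (G.neighborFinset y)
      (fun z hz => by
        by_contra hz'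
        rw [← ne_eq, hFn, hHa] at hz'
        exact hz (by simpa using hz'.1)) ∅
      (by
        have := hdeg y
        rw [G.card_neighborFinset_eq_degree, Finset.card_empty]
        omega)
    exact ⟨m, hm⟩
  have hmissu : ∀ T : Finset (Fin (r + 2)), T.card ≤ 1 → ∃ m, IsMissing c F u m ∧ m ∉ T := by
    intro T hT
    refine exists_isMissing ((G.neighborFinset u).erase v) (fun z hz => ?_) T ?_
    · by_contra hz'
      rw [← ne_eq, hFn, hHa] at hz'
      exact hz (by simp; grind)
    · have := hdeg u
      have h0 : v ∈ G.neighborFinset u := by simpa using huv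
      have := Finset.card_pos.2 ⟨v, h0⟩
      rw [Finset.card_erase_of_mem h0, G.card_neighborFinset_eq_degree] at *
      omega
  obtain ⟨p, hp, -⟩ := hmissu ∅ (by simp)
  obtain ⟨q, hq, hqp⟩ := hmissu {p} (by simp)
  obtain ⟨m₁, hm₁⟩ := hmiss w₁
  obtain ⟨m₂, hm₂⟩ := hmiss w₂
  obtain ⟨m₃, hm₃⟩ := hmiss x
  obtain ⟨F', hF', hvu', hext⟩ := hD.fillable (fun e => hqp (by simp [e])) hp hq hm₁ hm₂ hm₃
  refine hasTotalColoring_of_isPartialColoring hF' ?_ ?_ (by omega)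
  · intro a b hab
    by_cases hH' : H.Adj a b
    · exact hext a b ((hFn a b).2 hH')
    · rw [hHa] at hH'
      have : (a = u ∧ b = v) ∨ (a = v ∧ b = u) := by tauto
      rcases this with ⟨rfl, rfl⟩ | ⟨rfl, rfl⟩
      · rwa [hF'.symm]
      · exact hvu'
  · intro a b ha hb hab
    exact hc a b ((hHa a b).2 ⟨hab, by tauto⟩)
end

section
/- Let r ≥ 13 be an integer and let G be an r-minimal graph with maximum degree Δ = Δ(G). Let V_3 be the set of vertices of G of degree 3 and V_Δ the set of vertices of G of degree Δ. Then |V_Δ| > 2·|V_3|. -/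
open Fin.CommRing in
/-- Lists of size two on the vertices of an even cycle admit a proper choice of colors. -/
lemma exists_list_coloring_even_cycle {α : Type*} {n : ℕ} (hn : Even (n + 3))
    (L : Fin (n + 3) → Finset α) (hL : ∀ i, 2 ≤ (L i).card) :
    ∃ c : Fin (n + 3) → α, (∀ i, c i ∈ L i) ∧ ∀ i, c i ≠ c (i + 1) := by
  classical
  by_cases h : ∀ k, L (k + 1) ⊆ L k
  · have hanti : ∀ a b : ℕ, a ≤ b → L (b : Fin (n + 3)) ⊆ L (a : Fin (n + 3)) := by
      intro a b hab
      induction b, hab using Nat.le_induction with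
      | base => exact subset_rfl
      | succ b _ ih =>
        push_cast
        exact (h _).trans ih
    have hsub : ∀ i : Fin (n + 3), L ((n + 2 : ℕ) : Fin (n + 3)) ⊆ L i := fun i => by
      have := hanti i.val (n + 2) (by omega)
      rwa [Fin.cast_val_eq_self] at this
    obtain ⟨a, ha, b, hb, hab⟩ := Finset.one_lt_card.1 (hL ((n + 2 : ℕ) : Fin (n + 3)))
    refine ⟨fun i => if Even i.val then a else b, fun i => ?_, fun i => ?_⟩
    · dsimp only
      split_ifs
      exacts [hsub i ha, hsub i hb]
    · have hodd : Even (i + 1 : Fin (n + 3)).val ↔ ¬ Even i.val := by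
        rw [Fin.val_add_one]
        split_ifs with hi
        · subst hi
          simp only [Fin.val_last]
          rw [Nat.even_add_one] at hn
          simpa using hn
        · exact Nat.even_add_one
      simp only [hodd]
      by_cases hi : Even i.val <;> simp [hi, hab, hab.symm]
  · push Not at h
    obtain ⟨k, hk⟩ := h
    obtain ⟨a, ha, hak⟩ := Finset.not_subset.1 hk
    have hnext : ∀ (i : Fin (n + 3)) (x : α), ∃ y ∈ L i, y ≠ x := fun i x =>
      Finset.exists_mem_ne (hL i) x
    choose f hfL hfne using hnext
    let g : ℕ → α := fun j => Nat.rec a (fun j x => f ((j + 1 : ℕ) + (k + 1)) x) j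
    have hg : ∀ j : ℕ, g j ∈ L ((j : Fin (n + 3)) + (k + 1)) := by
      intro j
      cases j with
      | zero => simpa [g] using ha
      | succ j => exact hfL _ _
    have hgne : ∀ j : ℕ, g j ≠ g (j + 1) := fun j => (hfne _ _).symm
    have hmem : ∀ i : Fin (n + 3), g (i - (k + 1)).val ∈ L i := fun i => by
      simpa using hg (i - (k + 1)).val
    refine ⟨fun i => g (i - (k + 1)).val, hmem, fun i => ?_⟩
    dsimp only
    rw [add_sub_right_comm, Fin.val_add_one]
    split_ifs with hi
    · have hik : i = k := by
        rw [sub_eq_iff_eq_add, add_comm k 1, ← add_assoc, Fin.last_add_one, zero_add] at hi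
        exact hi
      subst hik
      exact fun h => hak (by have := hmem i; rw [h] at this; exact this)
    · exact hgne _

/-- Uncolored vertices of small degree forming an independent set can be colored last. -/
lemma HasTotalColoring.of_partial {V : Type*} [Fintype V] {G : SimpleGraph V}
    [DecidableRel G.Adj] {k : ℕ} (T : Set V) (hT : ∀ u ∈ T, ∀ v ∈ T, ¬ G.Adj u v)
    (hdeg : ∀ v ∈ T, 2 * G.degree v < k) (cV : V → Fin k) (cE : Sym2 V → Fin k)
    (hV : ∀ u v, u ∉ T → v ∉ T → G.Adj u v → cV u ≠ cV v)
    (hE : ∀ e₁ ∈ G.edgeSet, ∀ e₂ ∈ G.edgeSet, e₁ ≠ e₂ → (∃ x, x ∈ e₁ ∧ x ∈ e₂) →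
      cE e₁ ≠ cE e₂)
    (hEV : ∀ e ∈ G.edgeSet, ∀ x ∈ e, x ∉ T → cE e ≠ cV x) :
    HasTotalColoring G k := by
  classical
  have hfree : ∀ v, ∃ c : Fin k, v ∈ T →
      (∀ w, G.Adj v w → c ≠ cV w) ∧ ∀ e ∈ G.edgeSet, v ∈ e → c ≠ cE e := by
    intro v
    by_cases hv : v ∈ T
    · let F := (G.neighborFinset v).image cV ∪ (G.incidenceFinset v).image cE
      have hF : F.card < (Finset.univ : Finset (Fin k)).card := by
        have h1 : ((G.neighborFinset v).image cV).card ≤ G.degree v := Finset.card_image_le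
        have h2 : ((G.incidenceFinset v).image cE).card ≤ G.degree v :=
          Finset.card_image_le.trans_eq (G.card_incidenceFinset_eq_degree v)
        have h3 : F.card ≤ _ := Finset.card_union_le _ _
        have := hdeg v hv
        rw [Finset.card_univ, Fintype.card_fin]
        omega
      obtain ⟨c, -, hc⟩ := Finset.exists_mem_notMem_of_card_lt_card hF
      simp only [F, Finset.mem_union, Finset.mem_image, not_or, not_exists, not_and] at hc
      refine ⟨c, fun _ => ⟨fun w hw h => hc.1 w (by simpa using hw) h.symm,
        fun e he hve h => hc.2 e ?_ h.symm⟩⟩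
      rw [SimpleGraph.mem_incidenceFinset]
      exact ⟨he, hve⟩
    · exact ⟨cV v, fun h => absurd h hv⟩
  choose f hf using hfree
  refine ⟨fun v => if v ∈ T then f v else cV v, cE, fun u v huv => ?_, hE, fun e he x hx => ?_⟩
  · by_cases hu : u ∈ T
    · have hv : v ∉ T := fun hv => hT u hu v hv huv
      simpa [hu, hv] using (hf u hu).1 v huv
    · by_cases hv : v ∈ T
      · simpa [hu, hv] using ((hf v hv).1 u huv.symm).symm
      · simpa [hu, hv] using hV u v hu hv huv
  · by_cases hxT : x ∈ T
    · simpa [hxT] using ((hf x hxT).2 e he hx).symm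
    · simpa [hxT] using hEV e he x hx hxT

/-- After uncoloring the edges of `C` and the vertices of `T`, a total coloring can be completed
from any proper coloring of `C` from suitable lists. -/
lemma exists_lists_of_hasTotalColoring_deleteEdges {V : Type*} [Fintype V] [DecidableEq V]
    {G : SimpleGraph V} [DecidableRel G.Adj] {k : ℕ} (C : Finset (Sym2 V)) {e₀ : Sym2 V}
    (he₀ : e₀ ∈ C) (hcol : HasTotalColoring (G.deleteEdges {e₀}) k)
    (T : Set V) (hT : ∀ u ∈ T, ∀ v ∈ T, ¬ G.Adj u v) (hdeg : ∀ v ∈ T, 2 * G.degree v < k)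
    (hCT : ∀ u v, u ∉ T → v ∉ T → s(u, v) ∉ C) :
    ∃ L : Sym2 V → Finset (Fin k),
      (∀ u v, u ∈ T → G.Adj u v →
        k + (G.incidenceFinset u ∩ C).card + (G.incidenceFinset v ∩ C).card ≤
          (L s(u, v)).card + G.degree u + G.degree v + 1) ∧
      ∀ c : Sym2 V → Fin k, (∀ e ∈ C, c e ∈ L e) →
        (∀ e₁ ∈ C, ∀ e₂ ∈ C, e₁ ≠ e₂ → (∃ x, x ∈ e₁ ∧ x ∈ e₂) → c e₁ ≠ c e₂) →
        HasTotalColoring G k := by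
  classical
  obtain ⟨cV, cE, hV, hE, hEV⟩ := hcol
  have hmem : ∀ e ∈ G.edgeSet, e ∉ C → e ∈ (G.deleteEdges {e₀}).edgeSet := by
    intro e he heC
    rw [SimpleGraph.edgeSet_deleteEdges]
    exact ⟨he, fun h => heC (h ▸ he₀)⟩
  let L : Sym2 V → Finset (Fin k) := fun e => Finset.univ.filter fun c =>
    (∀ e' ∈ G.edgeSet, e' ∉ C → (∃ x, x ∈ e ∧ x ∈ e') → c ≠ cE e') ∧
      ∀ x ∈ e, x ∉ T → c ≠ cV x
  refine ⟨L, fun u v hu huv => ?_, fun c hcL hcC => ?_⟩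
  · let F := ((G.incidenceFinset u \ C).image cE ∪ (G.incidenceFinset v \ C).image cE) ∪ {cV v}
    have hsub : Fᶜ ⊆ L s(u, v) := by
      intro c hc
      simp only [F, Finset.mem_compl, Finset.mem_union, Finset.mem_image, Finset.mem_sdiff,
        Finset.mem_singleton, SimpleGraph.mem_incidenceFinset, not_or, not_exists, not_and] at hc
      obtain ⟨⟨h1, h2⟩, h3⟩ := hc
      simp only [L, Finset.mem_filter, Finset.mem_univ, true_and, Sym2.mem_iff]
      refine ⟨?_, ?_⟩
      · rintro e' he' heC ⟨x, rfl | rfl, hx⟩ h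
        · exact h1 e' ⟨⟨he', hx⟩, heC⟩ h.symm
        · exact h2 e' ⟨⟨he', hx⟩, heC⟩ h.symm
      · rintro x (rfl | rfl) hx
        · exact absurd hu hx
        · exact h3
    have h0 := Finset.card_le_card hsub
    have h1 : ((G.incidenceFinset u \ C).image cE).card ≤ _ := Finset.card_image_le
    have h2 : ((G.incidenceFinset v \ C).image cE).card ≤ _ := Finset.card_image_le
    have h3 : F.card ≤ _ := Finset.card_union_le _ _
    have h4 := Finset.card_union_le ((G.incidenceFinset u \ C).image cE)
      ((G.incidenceFinset v \ C).image cE)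
    have h5 := Finset.card_sdiff_add_card_inter (G.incidenceFinset u) C
    have h6 := Finset.card_sdiff_add_card_inter (G.incidenceFinset v) C
    rw [G.card_incidenceFinset_eq_degree] at h5 h6
    rw [Finset.card_compl, Fintype.card_fin] at h0
    rw [Finset.card_singleton] at h3
    omega
  · have hL : ∀ e ∈ C, (∀ e' ∈ G.edgeSet, e' ∉ C → (∃ x, x ∈ e ∧ x ∈ e') → c e ≠ cE e') ∧
        ∀ x ∈ e, x ∉ T → c e ≠ cV x := fun e he => by
      simpa only [L, Finset.mem_filter, Finset.mem_univ, true_and] using hcL e he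
    refine HasTotalColoring.of_partial T hT hdeg cV (fun e => if e ∈ C then c e else cE e)
      (fun u v hu hv huv => hV u v (hmem s(u, v) huv (hCT u v hu hv))) ?_ ?_
    · intro e₁ h₁ e₂ h₂ hne hx
      by_cases hC₁ : e₁ ∈ C <;> by_cases hC₂ : e₂ ∈ C <;> simp only [hC₁, hC₂, if_true, if_false]
      · exact hcC e₁ hC₁ e₂ hC₂ hne hx
      · exact (hL e₁ hC₁).1 e₂ h₂ hC₂ hx
      · exact ((hL e₂ hC₂).1 e₁ h₁ hC₁ (hx.imp fun _ h => h.symm)).symm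
      · exact hE e₁ (hmem e₁ h₁ hC₁) e₂ (hmem e₂ h₂ hC₂) hne hx
    · intro e he x hx hxT
      by_cases heC : e ∈ C <;> simp only [heC, if_true, if_false]
      · exact (hL e heC).2 x hx hxT
      · exact hEV e (hmem e he heC) x hx

/-- In an `r`-minimal graph the neighbors of a vertex of degree three have degree `r`. -/
lemma IsRMinimal.degree_eq_of_adj {V : Type*} [Fintype V] {r : ℕ} (hr : 13 ≤ r)
    {G : SimpleGraph V} [DecidableRel G.Adj] (hG : IsRMinimal r G) {u v : V}
    (hu : G.degree u = 3) (huv : G.Adj u v) : G.degree v = r := by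
  classical
  obtain ⟨-, hmax, hno, hdel⟩ := hG
  refine le_antisymm ((G.degree_le_maxDegree v).trans hmax) ?_
  by_contra! hlt
  obtain ⟨L, hL, hext⟩ := exists_lists_of_hasTotalColoring_deleteEdges {s(u, v)}
    (Finset.mem_singleton_self _) (hdel s(u, v) huv) {u}
    (by rintro _ rfl _ rfl; exact G.irrefl) (by rintro _ rfl; omega)
    (by
      intro a b ha hb h
      have : u ∈ s(a, b) := by rw [Finset.mem_singleton.1 h]; exact Sym2.mem_mk_left u v
      rcases Sym2.mem_iff.1 this with rfl | rfl
      exacts [ha rfl, hb rfl])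
  have hinc : ∀ w ∈ s(u, v), 1 ≤ (G.incidenceFinset w ∩ {s(u, v)}).card := by
    intro w hw
    refine Finset.card_pos.2 ⟨s(u, v), ?_⟩
    rw [Finset.mem_inter, SimpleGraph.mem_incidenceFinset]
    exact ⟨⟨huv, hw⟩, Finset.mem_singleton_self _⟩
  have h1 := hinc u (Sym2.mem_mk_left u v)
  have h2 := hinc v (Sym2.mem_mk_right u v)
  have h3 := hL u v rfl huv
  obtain ⟨c, hc⟩ : (L s(u, v)).Nonempty := Finset.card_pos.1 (by omega)
  refine hno (hext (fun _ => c) ?_ ?_)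
  · intro e he
    rwa [Finset.mem_singleton.1 he]
  · intro e₁ h₁ e₂ h₂ hne
    exact absurd ((Finset.mem_singleton.1 h₁).trans (Finset.mem_singleton.1 h₂).symm) hne

/-- The spanning subgraph of `G` consisting of the edges with an endpoint of degree three. -/
def cubicEdgeGraph {V : Type*} [Fintype V] (G : SimpleGraph V) [DecidableRel G.Adj] :
    SimpleGraph V where
  Adj u v := G.Adj u v ∧ (G.degree u = 3 ∨ G.degree v = 3)
  symm := ⟨fun _ _ h => ⟨h.1.symm, h.2.symm⟩⟩
  loopless := ⟨fun _ h => G.irrefl h.1⟩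

open Fin.CommRing in
/-- In an `r`-minimal graph, no cycle alternates between vertices of degree three and their
neighbors. -/
lemma IsRMinimal.isAcyclic_cubicEdgeGraph {V : Type*} [Fintype V] {r : ℕ} (hr : 13 ≤ r)
    {G : SimpleGraph V} [DecidableRel G.Adj] (hG : IsRMinimal r G) :
    (cubicEdgeGraph G).IsAcyclic := by
  classical
  rw [SimpleGraph.isAcyclic_iff_free_cycleGraph]
  rintro m hm ⟨f⟩
  obtain ⟨n, rfl⟩ : ∃ n, m = n + 3 := ⟨m - 3, by omega⟩
  have hadj : ∀ i, (cubicEdgeGraph G).Adj (f i) (f (i + 1)) := fun i =>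
    f.toHom.map_adj (SimpleGraph.cycleGraph_adj.2 (Or.inr (by simp)))
  have hinj : Function.Injective f := f.injective
  have htwo : (1 + 1 : Fin (n + 3)) ≠ 0 := by
    simp [Fin.ext_iff, Fin.val_add, Nat.mod_eq_of_lt (show 2 < n + 3 by omega)]
  have halt : ∀ i, G.degree (f (i + 1)) = 3 ↔ ¬ G.degree (f i) = 3 := by
    intro i
    obtain ⟨h, h' | h'⟩ := hadj i
    · have := hG.degree_eq_of_adj hr h' h
      omega
    · have := hG.degree_eq_of_adj hr h' h.symm
      omega
  have heven : Even (n + 3) := by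
    have key : ∀ j : ℕ, G.degree (f (j : Fin (n + 3))) = 3 ↔ (Even j ↔ G.degree (f 0) = 3) := by
      intro j
      induction j with
      | zero =>
        rw [Nat.cast_zero]
        simp
      | succ j ih =>
        rw [Nat.cast_succ, halt, ih, Nat.even_add_one]
        tauto
    have := key (n + 3)
    rw [Fin.natCast_self] at this
    tauto
  let e : Fin (n + 3) → Sym2 V := fun i => s(f i, f (i + 1))
  have heinj : Function.Injective e := by
    intro i j hij
    rcases Sym2.eq_iff.1 hij with ⟨h, -⟩ | ⟨h, h'⟩
    · exact hinj h
    · have h1 := hinj h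
      have h2 := hinj h'
      rw [h1, add_assoc, add_eq_left] at h2
      exact absurd h2 htwo
  let C := Finset.univ.image e
  have heC : ∀ i, e i ∈ C := fun i => Finset.mem_image_of_mem _ (Finset.mem_univ i)
  have hinc : ∀ i, 2 ≤ (G.incidenceFinset (f i) ∩ C).card := by
    intro i
    refine Finset.one_lt_card.2 ⟨e i, ?_, e (i - 1), ?_, ?_⟩
    · rw [Finset.mem_inter, SimpleGraph.mem_incidenceFinset]
      exact ⟨⟨(hadj i).1, Sym2.mem_mk_left _ _⟩, heC i⟩
    · rw [Finset.mem_inter, SimpleGraph.mem_incidenceFinset]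
      refine ⟨⟨(hadj (i - 1)).1, ?_⟩, heC (i - 1)⟩
      simp [e]
    · intro h
      have := heinj h
      rw [eq_comm, sub_eq_self] at this
      simp at this
  obtain ⟨L, hL, hext⟩ := exists_lists_of_hasTotalColoring_deleteEdges C (heC 0)
    (hG.2.2.2 (e 0) (hadj 0).1) {v | G.degree v = 3}
    (fun u hu v hv huv => by
      have := hG.degree_eq_of_adj hr hu huv
      have : G.degree v = 3 := hv
      omega)
    (fun v hv => by
      have : G.degree v = 3 := hv
      omega)
    (by
      intro u v hu hv h
      obtain ⟨i, -, hi⟩ := Finset.mem_image.1 h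
      have : (cubicEdgeGraph G).Adj u v := by
        rw [← SimpleGraph.mem_edgeSet, ← hi]
        exact hadj i
      exact this.2.elim hu hv)
  have hcard : ∀ i, 2 ≤ (L (e i)).card := by
    intro i
    have h1 := hinc i
    have h2 := hinc (i + 1)
    obtain ⟨h, h' | h'⟩ := hadj i
    · have h3 := hL _ _ h' h
      have h4 := hG.degree_eq_of_adj hr h' h
      change 2 ≤ (L s(f i, f (i + 1))).card
      omega
    · have h3 := hL _ _ h' h.symm
      have h4 := hG.degree_eq_of_adj hr h' h.symm
      change 2 ≤ (L s(f i, f (i + 1))).card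
      rw [Sym2.eq_swap]
      omega
  obtain ⟨c, hcL, hcne⟩ := exists_list_coloring_even_cycle heven (fun i => L (e i)) hcard
  have hinv : ∀ i, c (Function.invFun e (e i)) = c i := fun i => by
    rw [Function.leftInverse_invFun heinj i]
  refine hG.2.2.1 (hext (fun x => c (Function.invFun e x)) ?_ ?_)
  · intro x hx
    obtain ⟨i, -, rfl⟩ := Finset.mem_image.1 hx
    simpa only [hinv] using hcL i
  · intro x hx y hy hxy hz
    obtain ⟨i, -, rfl⟩ := Finset.mem_image.1 hx
    obtain ⟨j, -, rfl⟩ := Finset.mem_image.1 hy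
    simp only [hinv]
    obtain ⟨z, hzi, hzj⟩ := hz
    have hij : i ≠ j := fun h => hxy (by rw [h])
    rcases Sym2.mem_iff.1 hzi with h | h <;> rcases Sym2.mem_iff.1 hzj with h' | h' <;>
      have hh := hinj (h.symm.trans h')
    · exact absurd hh hij
    · rw [hh]
      exact (hcne j).symm
    · rw [← hh]
      exact hcne i
    · exact absurd (add_right_cancel hh) hij

lemma SimpleGraph.IsAcyclic.card_edgeFinset_lt {V : Type*} [Fintype V] [Nonempty V]
    {H : SimpleGraph V} [Fintype H.edgeSet] (hH : H.IsAcyclic) :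
    H.edgeFinset.card < Fintype.card V := by
  classical
  obtain ⟨F, hHF, -, hF⟩ :=
    SimpleGraph.connected_top.exists_isTree_le_of_le_of_isAcyclic le_top hH
  have h1 := hF.card_edgeFinset
  have h2 : H.edgeFinset.card ≤ F.edgeFinset.card :=
    Finset.card_le_card (SimpleGraph.edgeFinset_mono hHF)
  omega

/-- In an r-minimal graph (r ≥ 13) with maximum degree Δ, the number of
vertices of degree Δ is more than twice the number of vertices of degree 3. -/
theorem stmt_4 {V : Type*} [Fintype V] (r : ℕ) (hr : 13 ≤ r)
    (G : SimpleGraph V) [DecidableRel G.Adj] (hG : IsRMinimal r G) :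
    2 * (Finset.univ.filter (fun w => G.degree w = 3)).card <
      (Finset.univ.filter (fun w => G.degree w = G.maxDegree)).card := by
  classical
  rcases Finset.eq_empty_or_nonempty (Finset.univ.filter fun w => G.degree w = 3) with h3 | ⟨u, hu⟩
  · have := hG.1.nonempty
    obtain ⟨v, hv⟩ := G.exists_maximal_degree_vertex
    rw [h3, Finset.card_empty, mul_zero]
    exact Finset.card_pos.2 ⟨v, by simp [hv]⟩
  have hu3 : G.degree u = 3 := by simpa using hu
  have hmax : G.maxDegree = r := by
    obtain ⟨v, hv⟩ := (G.degree_pos_iff_exists_adj u).1 (by omega)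
    refine le_antisymm hG.2.1 ?_
    rw [← hG.degree_eq_of_adj hr hu3 hv]
    exact G.degree_le_maxDegree v
  rw [hmax]
  set A := Finset.univ.filter fun w => G.degree w = 3
  set B := Finset.univ.filter fun w => G.degree w = r
  let H := cubicEdgeGraph G
  have hAB : Disjoint A B := by
    rw [Finset.disjoint_left]
    intro v hA hB
    simp only [A, B, Finset.mem_filter, Finset.mem_univ, true_and] at hA hB
    omega
  have hbip : H.IsBipartiteWith (A : Set V) (B : Set V) := by
    refine ⟨by exact_mod_cast hAB, ?_⟩
    rintro v w ⟨h, h' | h'⟩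
    · exact Or.inl ⟨by simpa [A] using h', by simpa [B] using hG.degree_eq_of_adj hr h' h⟩
    · exact Or.inr ⟨by simpa [B] using hG.degree_eq_of_adj hr h' h.symm, by simpa [A] using h'⟩
  have hsum := SimpleGraph.isBipartiteWith_sum_degrees_eq_card_edges hbip
  have hdeg : ∀ v ∈ A, H.degree v = 3 := by
    intro v hv
    have hv3 : G.degree v = 3 := by simpa [A] using hv
    rw [← hv3, ← SimpleGraph.card_neighborFinset_eq_degree,
      ← SimpleGraph.card_neighborFinset_eq_degree]
    congr 1
    ext w
    rw [SimpleGraph.mem_neighborFinset, SimpleGraph.mem_neighborFinset]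
    exact and_iff_left (Or.inl hv3)
  rw [Finset.sum_congr rfl hdeg, Finset.sum_const, smul_eq_mul] at hsum
  have hsupp : H.support ⊆ ((A ∪ B : Finset V) : Set V) := by
    rw [Finset.coe_union]
    exact SimpleGraph.isBipartiteWith_support_subset hbip
  have hcard := SimpleGraph.card_edgeFinset_induce_of_support_subset hsupp
  have : Nonempty ((A ∪ B : Finset V) : Set V) := ⟨⟨u, by simp [hu]⟩⟩
  have hlt := ((hG.isAcyclic_cubicEdgeGraph hr).induce
    ((A ∪ B : Finset V) : Set V)).card_edgeFinset_lt
  have hV : Fintype.card ((A ∪ B : Finset V) : Set V) = A.card + B.card := by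
    rw [← Finset.card_union_of_disjoint hAB]
    simp
  have hfin : A.card * 3 < A.card + B.card := by
    rw [hsum, ← hV, ← hcard]
    convert hlt
  omega
end

section
/- Let r ≥ 13 be an integer and let G be a finite simple graph with maximum degree Δ(G) ≤ r in which no two vertices of degree 3 are adjacent. Let C be a cycle in G of even length such that every second vertex along C has degree 3 in G. If the graph G − E(C) obtained by deleting all edges of C admits a total (r+2)-coloring, then G itself admits a total (r+2)-coloring. -/
theorem Function.Periodic.exists_list_coloring {α : Type*} [DecidableEq α] {n : ℕ} (hn : Even n)
    (hn0 : 0 < n) {L : ℕ → Finset α} (hL : Function.Periodic L n) (hcard : ∀ t, 2 ≤ (L t).card) :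
    ∃ f : ℕ → α, Function.Periodic f n ∧ ∀ t, f t ∈ L t ∧ f t ≠ f (t + 1) := by
  by_cases hsub : ∀ t, L (t + 1) ⊆ L t
  · have hanti : Antitone L := antitone_nat_of_succ_le hsub
    have hconst : ∀ t, L t = L 0 := fun t => by
      refine le_antisymm (hanti (Nat.zero_le t)) ?_
      have h : L (0 + t * n) = L 0 := hL.nat_mul t 0
      rw [← h]
      exact hanti (by nlinarith)
    obtain ⟨a, ha, b, hb, hab⟩ := Finset.one_lt_card.mp (hcard 0)
    refine ⟨fun t => if Even t then a else b, fun t => ?_, fun t => ⟨?_, ?_⟩⟩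
    · simp [Nat.even_add, hn]
    · rw [hconst]
      dsimp only
      split_ifs <;> assumption
    · by_cases h : Even t <;> simp [Nat.even_add_one, h, hab, hab.symm]
  · push Not at hsub
    obtain ⟨i, hi⟩ := hsub
    obtain ⟨c, hc, hci⟩ := Finset.not_subset.mp hi
    have hnext : ∀ t (d : α), ∃ e ∈ L t, e ≠ d := fun t d =>
      Finset.exists_mem_ne (hcard t) d
    choose p hpL hpne using hnext
    let g : ℕ → α := fun k => Nat.rec c (fun m d => p (i + 1 + (m + 1)) d) k
    have hgL : ∀ k, g k ∈ L (i + 1 + k) := by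
      rintro (_ | k)
      · exact hc
      · exact hpL _ _
    have hgne : ∀ k, g k ≠ g (k + 1) := fun k => (hpne _ _).symm
    have hmodL : ∀ t, L (i + 1 + t % n) = L (i + 1 + t) := fun t => by
      conv_rhs => rw [← Nat.mod_add_div t n, mul_comm n, ← add_assoc]
      exact (hL.nat_mul _ _).symm
    refine ⟨fun t => g ((t + (n - 1) * (i + 1)) % n), fun t => ?_, fun t => ⟨?_, ?_⟩⟩
    · simp [add_right_comm t n]
    · have h := hgL ((t + (n - 1) * (i + 1)) % n)
      rw [hmodL] at h
      have e : i + 1 + (t + (n - 1) * (i + 1)) = t + (i + 1) * n := by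
        obtain ⟨m, rfl⟩ : ∃ m, n = m + 1 := ⟨n - 1, by omega⟩
        simp only [Nat.add_sub_cancel]
        ring
      rw [e] at h
      rwa [show L (t + (i + 1) * n) = L t from hL.nat_mul (i + 1) t] at h
    · dsimp only
      rw [add_right_comm]
      generalize t + (n - 1) * (i + 1) = s
      have hs : s % n < n := Nat.mod_lt _ hn0
      rcases Nat.lt_or_ge (s % n + 1) n with h | h
      · have : (s + 1) % n = s % n + 1 := by
          rw [Nat.add_mod, Nat.mod_eq_of_lt (a := 1) (by omega), Nat.mod_eq_of_lt h]
        rw [this]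
        exact hgne _
      · have h1 : s % n + 1 = n := by omega
        have h0 : (s + 1) % n = 0 := by
          rw [← Nat.mod_add_mod, h1, Nat.mod_self]
        rw [h0]
        intro h'
        apply hci
        have h2 := hgL (s % n)
        rw [h', show i + 1 + s % n = i + n by omega, hL] at h2
        exact h2

theorem SimpleGraph.Walk.IsCycle.exists_periodic {V : Type*} {G : SimpleGraph V} {x : V}
    {C : G.Walk x x} (hC : C.IsCycle) :
    ∃ v : ℕ → V, Function.Periodic v C.length ∧
      (∀ s t, v s = v t → s % C.length = t % C.length) ∧
      (∀ t, v t = C.getVert (t % C.length)) ∧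
      ∀ e, e ∈ C.edges ↔ ∃ t, e = s(v t, v (t + 1)) := by
  have hlen := hC.three_le_length
  have hmod : ∀ t, t % C.length < C.length := fun t => Nat.mod_lt _ (by omega)
  have hsucc : ∀ t, C.getVert ((t + 1) % C.length) = C.getVert (t % C.length + 1) := fun t => by
    rcases Nat.lt_or_ge (t % C.length + 1) C.length with h | h
    · rw [Nat.add_mod, Nat.mod_eq_of_lt (a := 1) (by omega), Nat.mod_eq_of_lt h]
    · have h1 : t % C.length + 1 = C.length := by have := hmod t; omega
      rw [← Nat.mod_add_mod, h1, Nat.mod_self]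
      simp
  refine ⟨fun t => C.getVert (t % C.length), fun t => by simp, fun s t h => ?_, fun _ => rfl,
    fun e => ?_⟩
  · exact hC.getVert_injOn' (by have := hmod s; simp only [Set.mem_ofPred_eq]; omega)
      (by have := hmod t; simp only [Set.mem_ofPred_eq]; omega) h
  · simp only [hsucc]
    rw [List.mem_iff_getElem]
    constructor
    · rintro ⟨i, hi, rfl⟩
      rw [C.length_edges] at hi
      exact ⟨i, by rw [Nat.mod_eq_of_lt hi]; simp [C.getElem_edges]⟩
    · rintro ⟨t, rfl⟩
      exact ⟨t % C.length, by simpa using hmod t, by simp [C.getElem_edges]⟩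

theorem hasTotalColoring_of_recolor {V : Type*} [Fintype V] {G : SimpleGraph V}
    [DecidableRel G.Adj] {k : ℕ} (S : Set V) (hS : ∀ u ∈ S, ∀ v ∈ S, ¬ G.Adj u v)
    (hdeg : ∀ v ∈ S, 2 * G.degree v < k) (cV : V → Fin k) (cE : Sym2 V → Fin k)
    (hV : ∀ u v, G.Adj u v → u ∉ S → v ∉ S → cV u ≠ cV v)
    (hE : ∀ e₁ ∈ G.edgeSet, ∀ e₂ ∈ G.edgeSet, e₁ ≠ e₂ → (∃ x, x ∈ e₁ ∧ x ∈ e₂) →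
      cE e₁ ≠ cE e₂)
    (hVE : ∀ e ∈ G.edgeSet, ∀ x ∈ e, x ∉ S → cE e ≠ cV x) :
    HasTotalColoring G k := by
  classical
  have hfree : ∀ v, ∃ c, v ∈ S → ∀ u, G.Adj v u → c ≠ cV u ∧ c ≠ cE s(v, u) := by
    intro v
    by_cases hv : v ∈ S
    · let F := (G.neighborFinset v).image cV ∪ (G.neighborFinset v).image fun u => cE s(v, u)
      have hF : F.card < (Finset.univ : Finset (Fin k)).card := by
        have h1 := Finset.card_union_le ((G.neighborFinset v).image cV)
          ((G.neighborFinset v).image fun u => cE s(v, u))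
        have h2 := Finset.card_image_le (s := G.neighborFinset v) (f := cV)
        have h3 := Finset.card_image_le (s := G.neighborFinset v) (f := fun u => cE s(v, u))
        have h4 := hdeg v hv
        rw [G.card_neighborFinset_eq_degree] at h2 h3
        rw [Finset.card_univ, Fintype.card_fin]
        exact (h1.trans (add_le_add h2 h3)).trans_lt (by omega)
      obtain ⟨c, -, hc⟩ := Finset.exists_mem_notMem_of_card_lt_card hF
      refine ⟨c, fun _ u hu => ⟨?_, ?_⟩⟩
      · rintro rfl
        exact hc (Finset.mem_union_left _ (Finset.mem_image_of_mem _ (by simpa using hu)))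
      · rintro rfl
        exact hc (Finset.mem_union_right _
          (Finset.mem_image.mpr ⟨u, by simpa using hu, rfl⟩))
    · exact ⟨cV v, fun h => absurd h hv⟩
  choose d hd using hfree
  refine ⟨fun v => if v ∈ S then d v else cV v, cE, fun u v huv => ?_, hE, fun e he x hx => ?_⟩
  · by_cases hu : u ∈ S <;> by_cases hv : v ∈ S
    · exact absurd huv (hS u hu v hv)
    · simpa [hu, hv] using (hd u hu v huv).1
    · simpa [hu, hv] using (hd v hv u huv.symm).1.symm
    · simpa [hu, hv] using hV u v huv hu hv
  · by_cases hxS : x ∈ S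
    · obtain ⟨y, rfl⟩ := hx
      simpa [hxS] using (hd x hxS y he).2.symm
    · simpa [hxS] using hVE e he x hx hxS

/-- Let Δ(G) ≤ r (r ≥ 13) and suppose no two vertices of degree 3 are
adjacent in G. Let C be a cycle of even length in G every second vertex of which has
degree 3. If G − E(C) admits a total (r+2)-coloring, then so does G. -/
theorem stmt_8 {V : Type*} [Fintype V] (r : ℕ) (hr : 13 ≤ r)
    (G : SimpleGraph V) [DecidableRel G.Adj] (hΔ : G.maxDegree ≤ r)
    (hno33 : ∀ a b : V, G.Adj a b → ¬ (G.degree a = 3 ∧ G.degree b = 3))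
    (x : V) (C : G.Walk x x) (hC : C.IsCycle) (heven : Even C.length)
    (halt : ∀ i : ℕ, 2 * i < C.length → G.degree (C.getVert (2 * i)) = 3)
    (hcol : HasTotalColoring (G.deleteEdges {e | e ∈ C.edges}) (r + 2)) :
    HasTotalColoring G (r + 2) := by
  classical
  have hlen := hC.three_le_length
  obtain ⟨v, hvper, hvinj, hvC, hedge⟩ := hC.exists_periodic
  obtain ⟨cV, cE, hV, hE, hVE⟩ := hcol
  have hmemE : ∀ e, e ∈ (G.deleteEdges {e | e ∈ C.edges}).edgeSet ↔
      e ∈ G.edgeSet ∧ e ∉ C.edges := fun e => by simp [SimpleGraph.edgeSet_deleteEdges]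
  set H := G.deleteEdges {e | e ∈ C.edges}
  set n := C.length
  have hadj : ∀ t, G.Adj (v t) (v (t + 1)) := fun t =>
    C.edges_subset_edgeSet ((hedge _).mpr ⟨t, rfl⟩)
  have hdeg_even : ∀ t, Even t → G.degree (v t) = 3 := fun t ht => by
    have h1 : t % n < n := Nat.mod_lt _ (by omega)
    obtain ⟨i, hi⟩ : Even (t % n) := (heven.mod_even_iff).mpr ht
    rw [hvC, hi, ← two_mul]
    exact halt i (by omega)
  have hdeg_or : ∀ t, G.degree (v t) = 3 ∧ G.degree (v (t + 1)) ≠ 3 ∨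
      G.degree (v t) ≠ 3 ∧ G.degree (v (t + 1)) = 3 := fun t => by
    have h1 := hno33 _ _ (hadj t)
    rcases Nat.even_or_odd t with h | h
    · exact Or.inl ⟨hdeg_even t h, fun h' => h1 ⟨hdeg_even t h, h'⟩⟩
    · have h2 := hdeg_even (t + 1) h.add_one
      exact Or.inr ⟨fun h' => h1 ⟨h', h2⟩, h2⟩
  have hdegH : ∀ t, H.degree (v t) + 2 ≤ G.degree (v t) := fun t => by
    have hprev : v (t + n - 1 + 1) = v t := by
      rw [show t + n - 1 + 1 = t + n by omega, hvper]
    have hne : v (t + 1) ≠ v (t + n - 1) := fun h => by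
      have h1 : t + 1 ≡ t + n - 1 [MOD n] := hvinj _ _ h
      have h2 := (Nat.modEq_iff_dvd' (by omega)).mp h1
      have h3 := Nat.le_of_dvd (by omega) h2
      omega
    have hsub : H.neighborFinset (v t) ⊆
        G.neighborFinset (v t) \ {v (t + 1), v (t + n - 1)} := fun u hu => by
      have h1 := (hmemE s(v t, u)).mp (by simpa using hu)
      rw [hedge] at h1
      simp only [Finset.mem_sdiff, SimpleGraph.mem_neighborFinset, Finset.mem_insert,
        Finset.mem_singleton, not_or]
      refine ⟨h1.1, ?_, ?_⟩
      · rintro rfl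
        exact h1.2 ⟨t, rfl⟩
      · rintro rfl
        exact h1.2 ⟨t + n - 1, by rw [hprev, Sym2.eq_swap]⟩
    have hpair : {v (t + 1), v (t + n - 1)} ⊆ G.neighborFinset (v t) := fun u hu => by
      simp only [Finset.mem_insert, Finset.mem_singleton] at hu
      rw [SimpleGraph.mem_neighborFinset]
      rcases hu with rfl | rfl
      · exact hadj t
      · exact hprev ▸ (hadj (t + n - 1)).symm
    have h1 := Finset.card_le_card hsub
    have h2 := Finset.card_le_card hpair
    rw [Finset.card_sdiff_of_subset hpair] at h1
    rw [Finset.card_pair hne] at h1 h2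
    simp only [SimpleGraph.card_neighborFinset_eq_degree] at h1 h2
    omega
  let A : V → Finset (Fin (r + 2)) := fun w =>
    (H.neighborFinset w).image (fun u => cE s(w, u)) ∪ if G.degree w = 3 then ∅ else {cV w}
  have hA3 : ∀ t, G.degree (v t) = 3 → (A (v t)).card ≤ 1 := fun t ht => by
    have h1 := hdegH t
    have h2 := Finset.card_image_le (s := H.neighborFinset (v t)) (f := fun u => cE s(v t, u))
    rw [H.card_neighborFinset_eq_degree] at h2
    simp only [A, ht, if_true, Finset.union_empty]
    omega
  have hA : ∀ t, (A (v t)).card ≤ r - 1 := fun t => by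
    by_cases ht : G.degree (v t) = 3
    · have := hA3 t ht
      omega
    · have h1 := hdegH t
      have h2 := Finset.card_image_le (s := H.neighborFinset (v t)) (f := fun u => cE s(v t, u))
      rw [H.card_neighborFinset_eq_degree] at h2
      have h3 := (G.degree_le_maxDegree (v t)).trans hΔ
      have h4 := Finset.card_union_le ((H.neighborFinset (v t)).image fun u => cE s(v t, u))
        {cV (v t)}
      rw [Finset.card_singleton] at h4
      simp only [A, ht, if_false]
      omega
  have hLcard : ∀ t, 2 ≤ ((A (v t) ∪ A (v (t + 1)))ᶜ).card := fun t => by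
    rw [Finset.card_compl, Fintype.card_fin]
    have h1 := Finset.card_union_le (A (v t)) (A (v (t + 1)))
    have h2 := hA t
    have h3 := hA (t + 1)
    rcases hdeg_or t with h | h
    · have := hA3 _ h.1
      omega
    · have := hA3 _ h.2
      omega
  obtain ⟨f, hfper, hf⟩ := Function.Periodic.exists_list_coloring heven (by omega)
    (L := fun t => (A (v t) ∪ A (v (t + 1)))ᶜ)
    (fun t => by simp only [add_right_comm t n 1, hvper t, hvper (t + 1)]) hLcard
  have hfmod : ∀ s t, v s = v t → f s = f t := fun s t h => by
    rw [← hfper.map_mod_nat s, hvinj s t h, hfper.map_mod_nat]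
  have hfA : ∀ t w, w ∈ s(v t, v (t + 1)) → f t ∉ A w := fun t w hw => by
    have h := (hf t).1
    simp only [Finset.mem_compl, Finset.mem_union, not_or] at h
    rcases Sym2.mem_iff.mp hw with rfl | rfl
    exacts [h.1, h.2]
  have hnew : ∀ e, ∃ c, (e ∉ C.edges → c = cE e) ∧
      (e ∈ C.edges → ∃ t, e = s(v t, v (t + 1)) ∧ c = f t) := fun e => by
    by_cases he : e ∈ C.edges
    · obtain ⟨t, ht⟩ := (hedge e).mp he
      exact ⟨f t, fun h => absurd he h, fun _ => ⟨t, ht, rfl⟩⟩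
    · exact ⟨cE e, fun _ => rfl, fun h => absurd h he⟩
  choose c hcold hcnew using hnew
  have hmixed : ∀ e₁ ∈ C.edges, ∀ e₂ ∈ G.edgeSet, e₂ ∉ C.edges → (∃ x, x ∈ e₁ ∧ x ∈ e₂) →
      c e₁ ≠ c e₂ := by
    rintro e₁ h₁ e₂ h₂ h₂' ⟨w, hw₁, y, rfl⟩ heq
    obtain ⟨t, rfl, ht⟩ := hcnew e₁ h₁
    apply hfA t w hw₁
    rw [← ht, heq, hcold _ h₂']
    refine Finset.mem_union_left _ (Finset.mem_image.mpr ⟨y, ?_, rfl⟩)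
    rw [SimpleGraph.mem_neighborFinset]
    exact (hmemE s(w, y)).mpr ⟨h₂, h₂'⟩
  refine hasTotalColoring_of_recolor {w | G.degree w = 3} (fun u hu w hw h => hno33 u w h ⟨hu, hw⟩)
    (fun w hw => by rw [show G.degree w = 3 from hw]; omega) cV c ?_ ?_ ?_
  · intro u w huw hu hw
    refine hV u w ((hmemE s(u, w)).mpr ⟨huw, fun he => ?_⟩)
    obtain ⟨t, ht⟩ := (hedge _).mp he
    simp only [Set.mem_ofPred_eq] at hu hw
    have := hdeg_or t
    rcases Sym2.eq_iff.mp ht with ⟨rfl, rfl⟩ | ⟨rfl, rfl⟩ <;> tauto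
  · intro e₁ h₁ e₂ h₂ hne hx
    by_cases h₁' : e₁ ∈ C.edges <;> by_cases h₂' : e₂ ∈ C.edges
    · obtain ⟨s, rfl, hs⟩ := hcnew e₁ h₁'
      obtain ⟨t, rfl, ht⟩ := hcnew e₂ h₂'
      have hstep : ∀ s t, v s = v t → v (s + 1) = v (t + 1) := fun s t h => by
        have hmod : s + 1 ≡ t + 1 [MOD n] := Nat.ModEq.add_right 1 (hvinj s t h)
        rw [← hvper.map_mod_nat (s + 1), hmod, hvper.map_mod_nat]
      have hback : ∀ s t, v (s + 1) = v (t + 1) → v s = v t := fun s t h => by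
        have hmod : s ≡ t [MOD n] := Nat.ModEq.add_right_cancel' 1 (hvinj _ _ h)
        rw [← hvper.map_mod_nat s, hmod, hvper.map_mod_nat]
      rw [hs, ht]
      obtain ⟨w, hw₁, hw₂⟩ := hx
      rcases Sym2.mem_iff.mp hw₁ with rfl | rfl <;> rcases Sym2.mem_iff.mp hw₂ with h | h
      · exact absurd (by rw [h, hstep _ _ h]) hne
      · rw [hfmod _ _ h]
        exact (hf t).2.symm
      · rw [← hfmod _ _ h]
        exact (hf s).2
      · exact absurd (by rw [h, hback _ _ h]) hne
    · exact hmixed e₁ h₁' e₂ h₂ h₂' hx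
    · exact (hmixed e₂ h₂' e₁ h₁ h₁' (hx.imp fun _ => And.symm)).symm
    · rw [hcold _ h₁', hcold _ h₂']
      exact hE _ ((hmemE _).mpr ⟨h₁, h₁'⟩) _ ((hmemE _).mpr ⟨h₂, h₂'⟩) hne hx
  · intro e he w hw hw3
    by_cases he' : e ∈ C.edges
    · obtain ⟨t, rfl, ht⟩ := hcnew e he'
      rw [ht]
      intro h
      apply hfA t w hw
      rw [h]
      apply Finset.mem_union_right
      rw [if_neg (show G.degree w ≠ 3 from hw3)]
      exact Finset.mem_singleton_self _
    · rw [hcold e he']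
      exact hVE e ((hmemE e).mpr ⟨he, he'⟩) w hw
end
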